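/- arXiv:2003.03195 — 7 statements merged into one kernel-verified Lean document; each statement's English description precedes it below -/
import Mathlib

section
/- Characteristic polynomial factorization (Section 2): For every Φ ∈ ℝ⁶ and every λ ∈ ℝ, det(λ·I₆ − A(Φ)) = (λ² − b)·((λ² − a)(λ² − b) − (c² + d²)). -/
set_option linter.unusedVariables false

noncomputable section

open Real Matrix

/-- `a = c₁² + 2σ₀φ₁`. -/
def aa (c₁ σ₀ : ℝ) (Φ : Fin 6 → ℝ) : ℝ := c₁ ^ 2 + 2 * σ₀ * Φ 0
/-- `b = c₂² + 2σ₁φ₁`. -/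
def bb (c₂ σ₁ : ℝ) (Φ : Fin 6 → ℝ) : ℝ := c₂ ^ 2 + 2 * σ₁ * Φ 0
/-- `c = 2σ₁φ₂`. -/
def cc (σ₁ : ℝ) (Φ : Fin 6 → ℝ) : ℝ := 2 * σ₁ * Φ 1
/-- `d = 2σ₁φ₃`. -/
def dd (σ₁ : ℝ) (Φ : Fin 6 → ℝ) : ℝ := 2 * σ₁ * Φ 2

/-- The coefficient matrix `A(Φ)` of the 6×6 first-order system. -/
def Amat (c₁ c₂ σ₀ σ₁ : ℝ) (Φ : Fin 6 → ℝ) : Matrix (Fin 6) (Fin 6) ℝ :=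
  Matrix.of
    ![![0, 0, 0, -1, 0, 0],
      ![0, 0, 0, 0, -1, 0],
      ![0, 0, 0, 0, 0, -1],
      ![-aa c₁ σ₀ Φ, -cc σ₁ Φ, -dd σ₁ Φ, 0, 0, 0],
      ![-cc σ₁ Φ, -bb c₂ σ₁ Φ, 0, 0, 0, 0],
      ![-dd σ₁ Φ, 0, -bb c₂ σ₁ Φ, 0, 0, 0]]

/-- `Δ = (a−b)² + 4(c²+d²)`. -/
def Del (c₁ c₂ σ₀ σ₁ : ℝ) (Φ : Fin 6 → ℝ) : ℝ :=
  (aa c₁ σ₀ Φ - bb c₂ σ₁ Φ) ^ 2 + 4 * ((cc σ₁ Φ) ^ 2 + (dd σ₁ Φ) ^ 2)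

/-- `λ₁ = ((a+b)/2 + √Δ/2)^{1/2}`. -/
def lam1 (c₁ c₂ σ₀ σ₁ : ℝ) (Φ : Fin 6 → ℝ) : ℝ :=
  Real.sqrt ((aa c₁ σ₀ Φ + bb c₂ σ₁ Φ) / 2 + Real.sqrt (Del c₁ c₂ σ₀ σ₁ Φ) / 2)
/-- `λ₂ = √b`. -/
def lam2 (c₁ c₂ σ₀ σ₁ : ℝ) (Φ : Fin 6 → ℝ) : ℝ := Real.sqrt (bb c₂ σ₁ Φ)
/-- `λ₃ = ((a+b)/2 − √Δ/2)^{1/2}`. -/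
def lam3 (c₁ c₂ σ₀ σ₁ : ℝ) (Φ : Fin 6 → ℝ) : ℝ :=
  Real.sqrt ((aa c₁ σ₀ Φ + bb c₂ σ₁ Φ) / 2 - Real.sqrt (Del c₁ c₂ σ₀ σ₁ Φ) / 2)
/-- `λ₄ = −λ₃`. -/
def lam4 (c₁ c₂ σ₀ σ₁ : ℝ) (Φ : Fin 6 → ℝ) : ℝ := -lam3 c₁ c₂ σ₀ σ₁ Φ
/-- `λ₅ = −λ₂`. -/
def lam5 (c₁ c₂ σ₀ σ₁ : ℝ) (Φ : Fin 6 → ℝ) : ℝ := -lam2 c₁ c₂ σ₀ σ₁ Φ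
/-- `λ₆ = −λ₁`. -/
def lam6 (c₁ c₂ σ₀ σ₁ : ℝ) (Φ : Fin 6 → ℝ) : ℝ := -lam1 c₁ c₂ σ₀ σ₁ Φ

/-- Right eigenvector `r₁`. -/
def r1 (c₁ c₂ σ₀ σ₁ : ℝ) (Φ : Fin 6 → ℝ) : Fin 6 → ℝ :=
  ![((lam1 c₁ c₂ σ₀ σ₁ Φ) ^ 2 - bb c₂ σ₁ Φ) / (2 * σ₁), Φ 1, Φ 2,
    -(lam1 c₁ c₂ σ₀ σ₁ Φ * ((lam1 c₁ c₂ σ₀ σ₁ Φ) ^ 2 - bb c₂ σ₁ Φ)) / (2 * σ₁),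
    -(lam1 c₁ c₂ σ₀ σ₁ Φ) * Φ 1, -(lam1 c₁ c₂ σ₀ σ₁ Φ) * Φ 2]

/-- Right eigenvector `r₂`. -/
def r2 (c₁ c₂ σ₀ σ₁ : ℝ) (Φ : Fin 6 → ℝ) : Fin 6 → ℝ :=
  ![0, Φ 2, -Φ 1, 0, -(lam2 c₁ c₂ σ₀ σ₁ Φ) * Φ 2, lam2 c₁ c₂ σ₀ σ₁ Φ * Φ 1]

/-- Right eigenvector `r₃`. -/
def r3 (c₁ c₂ σ₀ σ₁ : ℝ) (Φ : Fin 6 → ℝ) : Fin 6 → ℝ :=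
  ![((lam3 c₁ c₂ σ₀ σ₁ Φ) ^ 2 - bb c₂ σ₁ Φ) / (2 * σ₁), Φ 1, Φ 2,
    -(lam3 c₁ c₂ σ₀ σ₁ Φ * ((lam3 c₁ c₂ σ₀ σ₁ Φ) ^ 2 - bb c₂ σ₁ Φ)) / (2 * σ₁),
    -(lam3 c₁ c₂ σ₀ σ₁ Φ) * Φ 1, -(lam3 c₁ c₂ σ₀ σ₁ Φ) * Φ 2]

/-- Right eigenvector `r₄`. -/
def r4 (c₁ c₂ σ₀ σ₁ : ℝ) (Φ : Fin 6 → ℝ) : Fin 6 → ℝ :=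
  ![((lam3 c₁ c₂ σ₀ σ₁ Φ) ^ 2 - bb c₂ σ₁ Φ) / (2 * σ₁), Φ 1, Φ 2,
    lam3 c₁ c₂ σ₀ σ₁ Φ * ((lam3 c₁ c₂ σ₀ σ₁ Φ) ^ 2 - bb c₂ σ₁ Φ) / (2 * σ₁),
    lam3 c₁ c₂ σ₀ σ₁ Φ * Φ 1, lam3 c₁ c₂ σ₀ σ₁ Φ * Φ 2]

/-- Right eigenvector `r₅`. -/
def r5 (c₁ c₂ σ₀ σ₁ : ℝ) (Φ : Fin 6 → ℝ) : Fin 6 → ℝ :=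
  ![0, Φ 2, -Φ 1, 0, lam2 c₁ c₂ σ₀ σ₁ Φ * Φ 2, -(lam2 c₁ c₂ σ₀ σ₁ Φ) * Φ 1]

/-- Right eigenvector `r₆`. -/
def r6 (c₁ c₂ σ₀ σ₁ : ℝ) (Φ : Fin 6 → ℝ) : Fin 6 → ℝ :=
  ![((lam1 c₁ c₂ σ₀ σ₁ Φ) ^ 2 - bb c₂ σ₁ Φ) / (2 * σ₁), Φ 1, Φ 2,
    lam1 c₁ c₂ σ₀ σ₁ Φ * ((lam1 c₁ c₂ σ₀ σ₁ Φ) ^ 2 - bb c₂ σ₁ Φ) / (2 * σ₁),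
    lam1 c₁ c₂ σ₀ σ₁ Φ * Φ 1, lam1 c₁ c₂ σ₀ σ₁ Φ * Φ 2]

/-- `K = (Δ + (a−b)√Δ)/(4σ₁²)`. -/
def Kc (c₁ c₂ σ₀ σ₁ : ℝ) (Φ : Fin 6 → ℝ) : ℝ :=
  (Del c₁ c₂ σ₀ σ₁ Φ + (aa c₁ σ₀ Φ - bb c₂ σ₁ Φ) * Real.sqrt (Del c₁ c₂ σ₀ σ₁ Φ)) /
    (4 * σ₁ ^ 2)

/-- `M = 2(φ₂²+φ₃²)`. -/
def Mc (Φ : Fin 6 → ℝ) : ℝ := 2 * ((Φ 1) ^ 2 + (Φ 2) ^ 2)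

/-- `N = (Δ − (a−b)√Δ)/(4σ₁²)`. -/
def Nc (c₁ c₂ σ₀ σ₁ : ℝ) (Φ : Fin 6 → ℝ) : ℝ :=
  (Del c₁ c₂ σ₀ σ₁ Φ - (aa c₁ σ₀ Φ - bb c₂ σ₁ Φ) * Real.sqrt (Del c₁ c₂ σ₀ σ₁ Φ)) /
    (4 * σ₁ ^ 2)

/-- Left eigenvector `l¹`. -/
def l1 (c₁ c₂ σ₀ σ₁ : ℝ) (Φ : Fin 6 → ℝ) : Fin 6 → ℝ :=
  (1 / Kc c₁ c₂ σ₀ σ₁ Φ) •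
    ![((lam1 c₁ c₂ σ₀ σ₁ Φ) ^ 2 - bb c₂ σ₁ Φ) / (2 * σ₁), Φ 1, Φ 2,
      -(((lam1 c₁ c₂ σ₀ σ₁ Φ) ^ 2 - bb c₂ σ₁ Φ) / (2 * σ₁ * lam1 c₁ c₂ σ₀ σ₁ Φ)),
      -(Φ 1 / lam1 c₁ c₂ σ₀ σ₁ Φ), -(Φ 2 / lam1 c₁ c₂ σ₀ σ₁ Φ)]

/-- Left eigenvector `l²`. -/
def l2 (c₁ c₂ σ₀ σ₁ : ℝ) (Φ : Fin 6 → ℝ) : Fin 6 → ℝ :=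
  (1 / Mc Φ) •
    ![0, Φ 2, -Φ 1, 0, -(Φ 2 / lam2 c₁ c₂ σ₀ σ₁ Φ), Φ 1 / lam2 c₁ c₂ σ₀ σ₁ Φ]

/-- Left eigenvector `l³`. -/
def l3 (c₁ c₂ σ₀ σ₁ : ℝ) (Φ : Fin 6 → ℝ) : Fin 6 → ℝ :=
  (1 / Nc c₁ c₂ σ₀ σ₁ Φ) •
    ![((lam3 c₁ c₂ σ₀ σ₁ Φ) ^ 2 - bb c₂ σ₁ Φ) / (2 * σ₁), Φ 1, Φ 2,
      -(((lam3 c₁ c₂ σ₀ σ₁ Φ) ^ 2 - bb c₂ σ₁ Φ) / (2 * σ₁ * lam3 c₁ c₂ σ₀ σ₁ Φ)),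
      -(Φ 1 / lam3 c₁ c₂ σ₀ σ₁ Φ), -(Φ 2 / lam3 c₁ c₂ σ₀ σ₁ Φ)]

/-- Left eigenvector `l⁴`. -/
def l4 (c₁ c₂ σ₀ σ₁ : ℝ) (Φ : Fin 6 → ℝ) : Fin 6 → ℝ :=
  (1 / Nc c₁ c₂ σ₀ σ₁ Φ) •
    ![((lam3 c₁ c₂ σ₀ σ₁ Φ) ^ 2 - bb c₂ σ₁ Φ) / (2 * σ₁), Φ 1, Φ 2,
      ((lam3 c₁ c₂ σ₀ σ₁ Φ) ^ 2 - bb c₂ σ₁ Φ) / (2 * σ₁ * lam3 c₁ c₂ σ₀ σ₁ Φ),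
      Φ 1 / lam3 c₁ c₂ σ₀ σ₁ Φ, Φ 2 / lam3 c₁ c₂ σ₀ σ₁ Φ]

/-- Left eigenvector `l⁵`. -/
def l5 (c₁ c₂ σ₀ σ₁ : ℝ) (Φ : Fin 6 → ℝ) : Fin 6 → ℝ :=
  (1 / Mc Φ) •
    ![0, Φ 2, -Φ 1, 0, Φ 2 / lam2 c₁ c₂ σ₀ σ₁ Φ, -(Φ 1 / lam2 c₁ c₂ σ₀ σ₁ Φ)]

/-- Left eigenvector `l⁶`. -/
def l6 (c₁ c₂ σ₀ σ₁ : ℝ) (Φ : Fin 6 → ℝ) : Fin 6 → ℝ :=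
  (1 / Kc c₁ c₂ σ₀ σ₁ Φ) •
    ![((lam1 c₁ c₂ σ₀ σ₁ Φ) ^ 2 - bb c₂ σ₁ Φ) / (2 * σ₁), Φ 1, Φ 2,
      ((lam1 c₁ c₂ σ₀ σ₁ Φ) ^ 2 - bb c₂ σ₁ Φ) / (2 * σ₁ * lam1 c₁ c₂ σ₀ σ₁ Φ),
      Φ 1 / lam1 c₁ c₂ σ₀ σ₁ Φ, Φ 2 / lam1 c₁ c₂ σ₀ σ₁ Φ]

/-- The family `i ↦ λ_i` (`i : Fin 6`, 0-indexed: `lamv 0 = λ₁`, …, `lamv 5 = λ₆`). -/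
def lamv (c₁ c₂ σ₀ σ₁ : ℝ) (i : Fin 6) (Φ : Fin 6 → ℝ) : ℝ :=
  ![lam1 c₁ c₂ σ₀ σ₁ Φ, lam2 c₁ c₂ σ₀ σ₁ Φ, lam3 c₁ c₂ σ₀ σ₁ Φ,
    lam4 c₁ c₂ σ₀ σ₁ Φ, lam5 c₁ c₂ σ₀ σ₁ Φ, lam6 c₁ c₂ σ₀ σ₁ Φ] i

/-- The family `i ↦ r_i` (0-indexed). -/
def rvK (c₁ c₂ σ₀ σ₁ : ℝ) (i : Fin 6) (Φ : Fin 6 → ℝ) : Fin 6 → ℝ :=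
  ![r1 c₁ c₂ σ₀ σ₁ Φ, r2 c₁ c₂ σ₀ σ₁ Φ, r3 c₁ c₂ σ₀ σ₁ Φ,
    r4 c₁ c₂ σ₀ σ₁ Φ, r5 c₁ c₂ σ₀ σ₁ Φ, r6 c₁ c₂ σ₀ σ₁ Φ] i

/-- The family `i ↦ l^i` (0-indexed). -/
def lvK (c₁ c₂ σ₀ σ₁ : ℝ) (i : Fin 6) (Φ : Fin 6 → ℝ) : Fin 6 → ℝ :=
  ![l1 c₁ c₂ σ₀ σ₁ Φ, l2 c₁ c₂ σ₀ σ₁ Φ, l3 c₁ c₂ σ₀ σ₁ Φ,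
    l4 c₁ c₂ σ₀ σ₁ Φ, l5 c₁ c₂ σ₀ σ₁ Φ, l6 c₁ c₂ σ₀ σ₁ Φ] i

/-- `c_{im}^i(Φ) = ∇λ_i(Φ)·r_m(Φ)` (as a directional derivative; 0-indexed). -/
def cC (c₁ c₂ σ₀ σ₁ : ℝ) (i m : Fin 6) (Φ : Fin 6 → ℝ) : ℝ :=
  fderiv ℝ (lamv c₁ c₂ σ₀ σ₁ i) Φ (rvK c₁ c₂ σ₀ σ₁ m Φ)

/-- `γ_{im}^i(Φ) = −(λ_i−λ_m)·l^i(Φ)·(Dr_i(Φ)[r_m(Φ)] − Dr_m(Φ)[r_i(Φ)])` (0-indexed). -/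
def gamS (c₁ c₂ σ₀ σ₁ : ℝ) (i m : Fin 6) (Φ : Fin 6 → ℝ) : ℝ :=
  -(lamv c₁ c₂ σ₀ σ₁ i Φ - lamv c₁ c₂ σ₀ σ₁ m Φ) *
    (lvK c₁ c₂ σ₀ σ₁ i Φ ⬝ᵥ
      (fderiv ℝ (rvK c₁ c₂ σ₀ σ₁ i) Φ (rvK c₁ c₂ σ₀ σ₁ m Φ)
        - fderiv ℝ (rvK c₁ c₂ σ₀ σ₁ m) Φ (rvK c₁ c₂ σ₀ σ₁ i Φ)))

/-- `γ_{km}^i(Φ) = −(λ_k−λ_m)·l^i(Φ)·Dr_k(Φ)[r_m(Φ)]` for `k ≠ i`, `m ≠ i`, `k ≠ m`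
(0-indexed). -/
def gamD (c₁ c₂ σ₀ σ₁ : ℝ) (i k m : Fin 6) (Φ : Fin 6 → ℝ) : ℝ :=
  -(lamv c₁ c₂ σ₀ σ₁ k Φ - lamv c₁ c₂ σ₀ σ₁ m Φ) *
    (lvK c₁ c₂ σ₀ σ₁ i Φ ⬝ᵥ fderiv ℝ (rvK c₁ c₂ σ₀ σ₁ k) Φ (rvK c₁ c₂ σ₀ σ₁ m Φ))

/-- **Characteristic polynomial factorization** (Section 2):
`det(λI₆ − A(Φ)) = (λ²−b)((λ²−a)(λ²−b) − (c²+d²))`. -/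
theorem charpoly_factorization (c₁ c₂ σ₀ σ₁ : ℝ) (hc : c₂ < c₁) (hc2 : 0 < c₂)
    (hσ0 : σ₀ ≠ 0) (hσ1 : σ₁ ≠ 0) :
    ∀ (Φ : Fin 6 → ℝ) (lam : ℝ),
      (lam • (1 : Matrix (Fin 6) (Fin 6) ℝ) - Amat c₁ c₂ σ₀ σ₁ Φ).det
        = (lam ^ 2 - bb c₂ σ₁ Φ) *
          ((lam ^ 2 - aa c₁ σ₀ Φ) * (lam ^ 2 - bb c₂ σ₁ Φ)
            - ((cc σ₁ Φ) ^ 2 + (dd σ₁ Φ) ^ 2)) := by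
  intro Φ lam
  simp only [Amat]
  generalize aa c₁ σ₀ Φ = a
  generalize bb c₂ σ₁ Φ = b
  generalize cc σ₁ Φ = c
  generalize dd σ₁ Φ = d
  have h : lam • (1 : Matrix (Fin 6) (Fin 6) ℝ) - Matrix.of
      ![![0, 0, 0, -1, 0, 0], ![0, 0, 0, 0, -1, 0], ![0, 0, 0, 0, 0, -1],
        ![-a, -c, -d, 0, 0, 0], ![-c, -b, 0, 0, 0, 0], ![-d, 0, -b, 0, 0, 0]] =
      !![lam, 0, 0, 1, 0, 0; 0, lam, 0, 0, 1, 0; 0, 0, lam, 0, 0, 1;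
        a, c, d, lam, 0, 0; c, b, 0, 0, lam, 0; d, 0, b, 0, 0, lam] := by
    ext i j
    fin_cases i <;> fin_cases j <;> simp
  rw [h]
  simp [Matrix.det_succ_row_zero, Fin.sum_univ_succ, Fin.succAbove]
  ring
end
end

section
/- Non-strict hyperbolicity of the 6×6 system (Lemma of Section 2): There exists δ > 0 such that for every Φ ∈ ℝ⁶ with |Φ| < 2δ: (i) b > 0, Δ > 0 and (a+b)/2 − (1/2)√Δ > 0, so λ₁,…,λ₆ are well-defined real numbers; (ii) det(λ·I₆ − A(Φ)) = (λ−λ₁)(λ−λ₂)(λ−λ₃)(λ−λ₄)(λ−λ₅)(λ−λ₆) for every λ ∈ ℝ, i.e. λ₁,…,λ₆ are the eigenvalues of A(Φ) counted with multiplicity; (iii) λ₆ < λ₅ ≤ λ₄ < λ₃ ≤ λ₂ < λ₁; (iv) λ₂ = λ₃ if and only if φ₂ = φ₃ = 0, and likewise λ₄ = λ₅ if and only if φ₂ = φ₃ = 0; (v) at Φ = 0 one has (λ₁,λ₂,λ₃,λ₄,λ₅,λ₆) = (c₁, c₂, c₂, −c₂, −c₂, −c₁). -/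
set_option linter.unusedVariables false

noncomputable section

open Real Matrix

/-- The determinant of `lam • 1 - A(Φ)`, as a polynomial in `lam`. -/
theorem det_smul_one_sub_Amat (c₁ c₂ σ₀ σ₁ : ℝ) (Φ : Fin 6 → ℝ) (lam : ℝ) :
    (lam • (1 : Matrix (Fin 6) (Fin 6) ℝ) - Amat c₁ c₂ σ₀ σ₁ Φ).det =
      (lam ^ 2 - bb c₂ σ₁ Φ) *
        (lam ^ 4 - (aa c₁ σ₀ Φ + bb c₂ σ₁ Φ) * lam ^ 2 +
          (aa c₁ σ₀ Φ * bb c₂ σ₁ Φ - (cc σ₁ Φ ^ 2 + dd σ₁ Φ ^ 2))) := by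
  have h : lam • (1 : Matrix (Fin 6) (Fin 6) ℝ) - Amat c₁ c₂ σ₀ σ₁ Φ =
      Matrix.of
        ![![lam, 0, 0, 1, 0, 0],
          ![0, lam, 0, 0, 1, 0],
          ![0, 0, lam, 0, 0, 1],
          ![aa c₁ σ₀ Φ, cc σ₁ Φ, dd σ₁ Φ, lam, 0, 0],
          ![cc σ₁ Φ, bb c₂ σ₁ Φ, 0, 0, lam, 0],
          ![dd σ₁ Φ, 0, bb c₂ σ₁ Φ, 0, 0, lam]] := by
    ext i j
    fin_cases i <;> fin_cases j <;> simp [Amat]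
  rw [h]
  simp [Matrix.det_succ_row_zero, Fin.sum_univ_succ, Fin.succAbove]
  ring

/-- Near the origin, `b > 0`, `a > b` and `c² + d² < ab`. -/
theorem exists_radius_coeff_bounds {c₁ c₂ : ℝ} (σ₀ σ₁ : ℝ) (hc : c₂ < c₁) (hc2 : 0 < c₂) :
    ∃ δ > (0 : ℝ), ∀ Φ : Fin 6 → ℝ, ‖Φ‖ < 2 * δ →
      0 < bb c₂ σ₁ Φ ∧ bb c₂ σ₁ Φ < aa c₁ σ₀ Φ ∧
        cc σ₁ Φ ^ 2 + dd σ₁ Φ ^ 2 < aa c₁ σ₀ Φ * bb c₂ σ₁ Φ := by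
  have ha : Continuous (aa c₁ σ₀) := by unfold aa; fun_prop
  have hb : Continuous (bb c₂ σ₁) := by unfold bb; fun_prop
  have hcc : Continuous (cc σ₁) := by unfold cc; fun_prop
  have hd : Continuous (dd σ₁) := by unfold dd; fun_prop
  have hopen : IsOpen {Φ : Fin 6 → ℝ | 0 < bb c₂ σ₁ Φ ∧ bb c₂ σ₁ Φ < aa c₁ σ₀ Φ ∧
      cc σ₁ Φ ^ 2 + dd σ₁ Φ ^ 2 < aa c₁ σ₀ Φ * bb c₂ σ₁ Φ} :=
    (isOpen_lt continuous_const hb).inter ((isOpen_lt hb ha).inter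
      (isOpen_lt ((hcc.pow 2).add (hd.pow 2)) (ha.mul hb)))
  have hc1 : 0 < c₁ := hc2.trans hc
  obtain ⟨ε, hε, hball⟩ := Metric.isOpen_iff.1 hopen 0 (by
    simp only [Set.mem_ofPred_eq, aa, bb, cc, dd, Pi.zero_apply, mul_zero, add_zero]
    refine ⟨by positivity, by gcongr, ?_⟩
    norm_num
    positivity)
  exact ⟨ε / 2, by positivity, fun Φ hΦ ↦ hball (by
    rw [mem_ball_zero_iff]
    linarith)⟩

/-- **Non-strict hyperbolicity of the 6×6 system** (Lemma of Section 2). -/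
theorem nonstrict_hyperbolicity (c₁ c₂ σ₀ σ₁ : ℝ) (hc : c₂ < c₁) (hc2 : 0 < c₂)
    (hσ0 : σ₀ ≠ 0) (hσ1 : σ₁ ≠ 0) :
    ∃ δ > (0 : ℝ),
      (∀ Φ : Fin 6 → ℝ, ‖Φ‖ < 2 * δ →
        -- (i) the radicands are positive, so `λ₁,…,λ₆` are well-defined real numbers
        (0 < bb c₂ σ₁ Φ ∧ 0 < Del c₁ c₂ σ₀ σ₁ Φ ∧
          0 < (aa c₁ σ₀ Φ + bb c₂ σ₁ Φ) / 2 - Real.sqrt (Del c₁ c₂ σ₀ σ₁ Φ) / 2) ∧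
        -- (ii) `λ₁,…,λ₆` are the eigenvalues of `A(Φ)` counted with multiplicity
        (∀ lam : ℝ,
          (lam • (1 : Matrix (Fin 6) (Fin 6) ℝ) - Amat c₁ c₂ σ₀ σ₁ Φ).det
            = (lam - lam1 c₁ c₂ σ₀ σ₁ Φ) * (lam - lam2 c₁ c₂ σ₀ σ₁ Φ) *
              (lam - lam3 c₁ c₂ σ₀ σ₁ Φ) * (lam - lam4 c₁ c₂ σ₀ σ₁ Φ) *
              (lam - lam5 c₁ c₂ σ₀ σ₁ Φ) * (lam - lam6 c₁ c₂ σ₀ σ₁ Φ)) ∧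
        -- (iii) ordering of the eigenvalues
        (lam6 c₁ c₂ σ₀ σ₁ Φ < lam5 c₁ c₂ σ₀ σ₁ Φ ∧
          lam5 c₁ c₂ σ₀ σ₁ Φ ≤ lam4 c₁ c₂ σ₀ σ₁ Φ ∧
          lam4 c₁ c₂ σ₀ σ₁ Φ < lam3 c₁ c₂ σ₀ σ₁ Φ ∧
          lam3 c₁ c₂ σ₀ σ₁ Φ ≤ lam2 c₁ c₂ σ₀ σ₁ Φ ∧
          lam2 c₁ c₂ σ₀ σ₁ Φ < lam1 c₁ c₂ σ₀ σ₁ Φ) ∧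
        -- (iv) equalities occur exactly when `φ₂ = φ₃ = 0`
        ((lam2 c₁ c₂ σ₀ σ₁ Φ = lam3 c₁ c₂ σ₀ σ₁ Φ ↔ Φ 1 = 0 ∧ Φ 2 = 0) ∧
          (lam4 c₁ c₂ σ₀ σ₁ Φ = lam5 c₁ c₂ σ₀ σ₁ Φ ↔ Φ 1 = 0 ∧ Φ 2 = 0))) ∧
      -- (v) values at `Φ = 0`
      (lam1 c₁ c₂ σ₀ σ₁ 0 = c₁ ∧ lam2 c₁ c₂ σ₀ σ₁ 0 = c₂ ∧ lam3 c₁ c₂ σ₀ σ₁ 0 = c₂ ∧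
        lam4 c₁ c₂ σ₀ σ₁ 0 = -c₂ ∧ lam5 c₁ c₂ σ₀ σ₁ 0 = -c₂ ∧ lam6 c₁ c₂ σ₀ σ₁ 0 = -c₁) := by
  have hc1 : 0 < c₁ := hc2.trans hc
  obtain ⟨δ, hδ, hbound⟩ := exists_radius_coeff_bounds σ₀ σ₁ hc hc2
  refine ⟨δ, hδ, fun Φ hΦ ↦ ?_, ?_⟩
  · obtain ⟨hb, hab, hcd⟩ := hbound Φ hΦ
    have hdet := det_smul_one_sub_Amat c₁ c₂ σ₀ σ₁ Φ
    have hcd_zero : cc σ₁ Φ ^ 2 + dd σ₁ Φ ^ 2 = 0 ↔ Φ 1 = 0 ∧ Φ 2 = 0 := by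
      rw [add_eq_zero_iff_of_nonneg (sq_nonneg _) (sq_nonneg _)]
      simp [cc, dd, hσ1]
    simp only [lam4, lam5, lam6, lam1, lam2, lam3, Del]
    generalize aa c₁ σ₀ Φ = a at *
    generalize bb c₂ σ₁ Φ = b at *
    have hq : 0 ≤ cc σ₁ Φ ^ 2 + dd σ₁ Φ ^ 2 := by positivity
    generalize cc σ₁ Φ ^ 2 + dd σ₁ Φ ^ 2 = q at *
    have hΔ : 0 < (a - b) ^ 2 + 4 * q := by nlinarith [pow_pos (sub_pos.2 hab) 2]
    have hs := Real.sq_sqrt hΔ.le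
    have hs0 := Real.sqrt_nonneg ((a - b) ^ 2 + 4 * q)
    generalize √((a - b) ^ 2 + 4 * q) = s at *
    have hs_lt : s < a + b := by nlinarith
    have hs_ge : a - b ≤ s := by nlinarith
    have h3 : 0 < (a + b) / 2 - s / 2 := by linarith
    have h23 : √b = √((a + b) / 2 - s / 2) ↔ Φ 1 = 0 ∧ Φ 2 = 0 := by
      rw [Real.sqrt_inj hb.le h3.le, ← hcd_zero]
      constructor
      · intro h
        have : s = a - b := by linarith
        subst this
        linarith
      · intro h
        have : s = a - b := by nlinarith
        linarith
    have h32 : √((a + b) / 2 - s / 2) ≤ √b := Real.sqrt_le_sqrt (by linarith)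
    have h21 : √b < √((a + b) / 2 + s / 2) := Real.sqrt_lt_sqrt hb.le (by linarith)
    have h3pos := Real.sqrt_pos.2 h3
    refine ⟨⟨hb, hΔ, h3⟩, fun lam ↦ ?_,
      ⟨neg_lt_neg h21, neg_le_neg h32, by linarith, h32, h21⟩,
      h23, by rw [neg_inj, eq_comm, h23]⟩
    have e1 : √((a + b) / 2 + s / 2) ^ 2 = (a + b) / 2 + s / 2 := Real.sq_sqrt (by linarith)
    have e2 : √b ^ 2 = b := Real.sq_sqrt hb.le
    have e3 : √((a + b) / 2 - s / 2) ^ 2 = (a + b) / 2 - s / 2 := Real.sq_sqrt h3.le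
    calc _ = (lam ^ 2 - b) * (lam ^ 4 - (a + b) * lam ^ 2 + (a * b - q)) := hdet lam
      _ = (lam ^ 2 - ((a + b) / 2 + s / 2)) * (lam ^ 2 - b) *
          (lam ^ 2 - ((a + b) / 2 - s / 2)) := by
        linear_combination (lam ^ 2 - b) / 4 * hs
      _ = (lam ^ 2 - √((a + b) / 2 + s / 2) ^ 2) * (lam ^ 2 - √b ^ 2) *
          (lam ^ 2 - √((a + b) / 2 - s / 2) ^ 2) := by rw [e1, e2, e3]
      _ = _ := by ring
  · have hs : √(Del c₁ c₂ σ₀ σ₁ 0) = c₁ ^ 2 - c₂ ^ 2 := by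
      have : Del c₁ c₂ σ₀ σ₁ 0 = (c₁ ^ 2 - c₂ ^ 2) ^ 2 := by simp [Del, aa, bb, cc, dd]
      rw [this, Real.sqrt_sq (by nlinarith)]
    have h1 : lam1 c₁ c₂ σ₀ σ₁ 0 = c₁ := by
      rw [lam1, hs, Real.sqrt_eq_iff_mul_self_eq_of_pos hc1]
      simp only [aa, bb, Pi.zero_apply]
      ring
    have h2 : lam2 c₁ c₂ σ₀ σ₁ 0 = c₂ := by
      rw [lam2, Real.sqrt_eq_iff_mul_self_eq_of_pos hc2]
      simp only [bb, Pi.zero_apply]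
      ring
    have h3 : lam3 c₁ c₂ σ₀ σ₁ 0 = c₂ := by
      rw [lam3, hs, Real.sqrt_eq_iff_mul_self_eq_of_pos hc2]
      simp only [aa, bb, Pi.zero_apply]
      ring
    exact ⟨h1, h2, h3, by rw [lam4, h3], by rw [lam5, h2], by rw [lam6, h1]⟩
end
end

section
/- Biorthogonality of the left and right eigenvectors (Section 2): There exists δ > 0 such that for every Φ ∈ ℝ⁶ with |Φ| < 2δ and (φ₂,φ₃) ≠ (0,0), the quantities K, M, N are nonzero and l^i · r_j = δ^i_j (Kronecker delta) for all i, j ∈ {1,…,6}. -/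
set_option linter.unusedVariables false

noncomputable section

open Real Matrix

/-- The vector `(u, μ u)` of `ℝ⁶` with `u = (x, y, z)`. -/
def stacked (μ x y z : ℝ) : Fin 6 → ℝ := ![x, y, z, μ * x, μ * y, μ * z]

theorem stacked_dotProduct_stacked (μ x y z ν x' y' z' : ℝ) :
    stacked μ x y z ⬝ᵥ stacked ν x' y' z' =
      (1 + μ * ν) * (x * x' + y * y' + z * z') := by
  simp [stacked, dotProduct, Fin.sum_univ_succ]
  ring

theorem r1_eq_stacked (c₁ c₂ σ₀ σ₁ : ℝ) (Φ : Fin 6 → ℝ) :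
    r1 c₁ c₂ σ₀ σ₁ Φ = stacked (-lam1 c₁ c₂ σ₀ σ₁ Φ)
      ((lam1 c₁ c₂ σ₀ σ₁ Φ ^ 2 - bb c₂ σ₁ Φ) / (2 * σ₁)) (Φ 1) (Φ 2) := by
  simp only [r1, stacked, Matrix.vecCons_inj, and_true, true_and]
  ring

theorem l1_eq_smul_stacked (c₁ c₂ σ₀ σ₁ : ℝ) (Φ : Fin 6 → ℝ) :
    l1 c₁ c₂ σ₀ σ₁ Φ = (Kc c₁ c₂ σ₀ σ₁ Φ)⁻¹ • stacked (-(lam1 c₁ c₂ σ₀ σ₁ Φ)⁻¹)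
      ((lam1 c₁ c₂ σ₀ σ₁ Φ ^ 2 - bb c₂ σ₁ Φ) / (2 * σ₁)) (Φ 1) (Φ 2) := by
  rw [l1, one_div, stacked]
  congr 1
  simp only [Matrix.vecCons_inj, and_true, true_and]
  refine ⟨?_, ?_, ?_⟩ <;> ring

theorem r2_eq_stacked (c₁ c₂ σ₀ σ₁ : ℝ) (Φ : Fin 6 → ℝ) :
    r2 c₁ c₂ σ₀ σ₁ Φ = stacked (-lam2 c₁ c₂ σ₀ σ₁ Φ)
      0 (Φ 2) (-Φ 1) := by
  simp only [r2, stacked, Matrix.vecCons_inj, and_true, true_and]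
  constructor <;> ring

theorem l2_eq_smul_stacked (c₁ c₂ σ₀ σ₁ : ℝ) (Φ : Fin 6 → ℝ) :
    l2 c₁ c₂ σ₀ σ₁ Φ = (Mc Φ)⁻¹ • stacked (-(lam2 c₁ c₂ σ₀ σ₁ Φ)⁻¹)
      0 (Φ 2) (-Φ 1) := by
  rw [l2, one_div, stacked]
  congr 1
  simp only [Matrix.vecCons_inj, and_true, true_and]
  refine ⟨?_, ?_, ?_⟩ <;> ring

theorem r3_eq_stacked (c₁ c₂ σ₀ σ₁ : ℝ) (Φ : Fin 6 → ℝ) :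
    r3 c₁ c₂ σ₀ σ₁ Φ = stacked (-lam3 c₁ c₂ σ₀ σ₁ Φ)
      ((lam3 c₁ c₂ σ₀ σ₁ Φ ^ 2 - bb c₂ σ₁ Φ) / (2 * σ₁)) (Φ 1) (Φ 2) := by
  simp only [r3, stacked, Matrix.vecCons_inj, and_true, true_and]
  ring

theorem l3_eq_smul_stacked (c₁ c₂ σ₀ σ₁ : ℝ) (Φ : Fin 6 → ℝ) :
    l3 c₁ c₂ σ₀ σ₁ Φ = (Nc c₁ c₂ σ₀ σ₁ Φ)⁻¹ • stacked (-(lam3 c₁ c₂ σ₀ σ₁ Φ)⁻¹)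
      ((lam3 c₁ c₂ σ₀ σ₁ Φ ^ 2 - bb c₂ σ₁ Φ) / (2 * σ₁)) (Φ 1) (Φ 2) := by
  rw [l3, one_div, stacked]
  congr 1
  simp only [Matrix.vecCons_inj, and_true, true_and]
  refine ⟨?_, ?_, ?_⟩ <;> ring

theorem r4_eq_stacked (c₁ c₂ σ₀ σ₁ : ℝ) (Φ : Fin 6 → ℝ) :
    r4 c₁ c₂ σ₀ σ₁ Φ = stacked (lam3 c₁ c₂ σ₀ σ₁ Φ)
      ((lam3 c₁ c₂ σ₀ σ₁ Φ ^ 2 - bb c₂ σ₁ Φ) / (2 * σ₁)) (Φ 1) (Φ 2) := by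
  simp only [r4, stacked, Matrix.vecCons_inj, and_true, true_and]
  ring

theorem l4_eq_smul_stacked (c₁ c₂ σ₀ σ₁ : ℝ) (Φ : Fin 6 → ℝ) :
    l4 c₁ c₂ σ₀ σ₁ Φ = (Nc c₁ c₂ σ₀ σ₁ Φ)⁻¹ • stacked (lam3 c₁ c₂ σ₀ σ₁ Φ)⁻¹
      ((lam3 c₁ c₂ σ₀ σ₁ Φ ^ 2 - bb c₂ σ₁ Φ) / (2 * σ₁)) (Φ 1) (Φ 2) := by
  rw [l4, one_div, stacked]
  congr 1
  simp only [Matrix.vecCons_inj, and_true, true_and]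
  refine ⟨?_, ?_, ?_⟩ <;> ring

theorem r5_eq_stacked (c₁ c₂ σ₀ σ₁ : ℝ) (Φ : Fin 6 → ℝ) :
    r5 c₁ c₂ σ₀ σ₁ Φ = stacked (lam2 c₁ c₂ σ₀ σ₁ Φ)
      0 (Φ 2) (-Φ 1) := by
  simp only [r5, stacked, Matrix.vecCons_inj, and_true, true_and]
  constructor <;> ring

theorem l5_eq_smul_stacked (c₁ c₂ σ₀ σ₁ : ℝ) (Φ : Fin 6 → ℝ) :
    l5 c₁ c₂ σ₀ σ₁ Φ = (Mc Φ)⁻¹ • stacked (lam2 c₁ c₂ σ₀ σ₁ Φ)⁻¹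
      0 (Φ 2) (-Φ 1) := by
  rw [l5, one_div, stacked]
  congr 1
  simp only [Matrix.vecCons_inj, and_true, true_and]
  refine ⟨?_, ?_, ?_⟩ <;> ring

theorem r6_eq_stacked (c₁ c₂ σ₀ σ₁ : ℝ) (Φ : Fin 6 → ℝ) :
    r6 c₁ c₂ σ₀ σ₁ Φ = stacked (lam1 c₁ c₂ σ₀ σ₁ Φ)
      ((lam1 c₁ c₂ σ₀ σ₁ Φ ^ 2 - bb c₂ σ₁ Φ) / (2 * σ₁)) (Φ 1) (Φ 2) := by
  simp only [r6, stacked, Matrix.vecCons_inj, and_true, true_and]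
  ring

theorem l6_eq_smul_stacked (c₁ c₂ σ₀ σ₁ : ℝ) (Φ : Fin 6 → ℝ) :
    l6 c₁ c₂ σ₀ σ₁ Φ = (Kc c₁ c₂ σ₀ σ₁ Φ)⁻¹ • stacked (lam1 c₁ c₂ σ₀ σ₁ Φ)⁻¹
      ((lam1 c₁ c₂ σ₀ σ₁ Φ ^ 2 - bb c₂ σ₁ Φ) / (2 * σ₁)) (Φ 1) (Φ 2) := by
  rw [l6, one_div, stacked]
  congr 1
  simp only [Matrix.vecCons_inj, and_true, true_and]
  refine ⟨?_, ?_, ?_⟩ <;> ring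

theorem exists_forall_norm_lt_coeff_pos (c₁ c₂ σ₀ σ₁ : ℝ) (h₁ : 0 < c₁) (h₂ : 0 < c₂) :
    ∃ δ > (0 : ℝ), ∀ Φ : Fin 6 → ℝ, ‖Φ‖ < 2 * δ →
      0 < aa c₁ σ₀ Φ ∧ 0 < bb c₂ σ₁ Φ ∧
        cc σ₁ Φ ^ 2 + dd σ₁ Φ ^ 2 < aa c₁ σ₀ Φ * bb c₂ σ₁ Φ := by
  have ha : Continuous (aa c₁ σ₀) := by unfold aa; fun_prop
  have hb : Continuous (bb c₂ σ₁) := by unfold bb; fun_prop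
  have hq : Continuous fun Φ ↦ cc σ₁ Φ ^ 2 + dd σ₁ Φ ^ 2 := by unfold cc dd; fun_prop
  have hopen : IsOpen {Φ | 0 < aa c₁ σ₀ Φ ∧ 0 < bb c₂ σ₁ Φ ∧
      cc σ₁ Φ ^ 2 + dd σ₁ Φ ^ 2 < aa c₁ σ₀ Φ * bb c₂ σ₁ Φ} :=
    (isOpen_lt continuous_const ha).inter
      ((isOpen_lt continuous_const hb).inter (isOpen_lt hq (ha.mul hb)))
  obtain ⟨ε, hε, hball⟩ := Metric.isOpen_iff.1 hopen 0 (by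
    simp only [Set.mem_ofPred_eq, aa, bb, cc, dd, Pi.zero_apply]
    norm_num
    exact ⟨by positivity, by positivity, by positivity⟩)
  exact ⟨ε / 2, by positivity, fun Φ hΦ ↦ hball (by
    rw [mem_ball_zero_iff]; linarith)⟩

/-- **Biorthogonality of the left and right eigenvectors** (Section 2):
for `(φ₂,φ₃) ≠ (0,0)` the normalizations `K, M, N` are nonzero and `l^i · r_j = δ^i_j`. -/
theorem biorthogonality (c₁ c₂ σ₀ σ₁ : ℝ) (hc : c₂ < c₁) (hc2 : 0 < c₂)
    (hσ0 : σ₀ ≠ 0) (hσ1 : σ₁ ≠ 0) :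
    ∃ δ > (0 : ℝ), ∀ Φ : Fin 6 → ℝ, ‖Φ‖ < 2 * δ → ¬(Φ 1 = 0 ∧ Φ 2 = 0) →
      Kc c₁ c₂ σ₀ σ₁ Φ ≠ 0 ∧ Mc Φ ≠ 0 ∧ Nc c₁ c₂ σ₀ σ₁ Φ ≠ 0 ∧
      ∀ i j : Fin 6,
        lvK c₁ c₂ σ₀ σ₁ i Φ ⬝ᵥ rvK c₁ c₂ σ₀ σ₁ j Φ = if i = j then 1 else 0 := by
  obtain ⟨δ, hδ, hpos⟩ := exists_forall_norm_lt_coeff_pos c₁ c₂ σ₀ σ₁ (hc2.trans hc) hc2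
  refine ⟨δ, hδ, fun Φ hΦ hne ↦ ?_⟩
  obtain ⟨ha, hb, hab⟩ := hpos Φ hΦ
  have hm : 0 < Φ 1 ^ 2 + Φ 2 ^ 2 := by
    by_contra! h
    exact hne ⟨by nlinarith [sq_nonneg (Φ 1), sq_nonneg (Φ 2)],
      by nlinarith [sq_nonneg (Φ 1), sq_nonneg (Φ 2)]⟩
  have hs := Real.sqrt_nonneg (Del c₁ c₂ σ₀ σ₁ Φ)
  have hs2 : √(Del c₁ c₂ σ₀ σ₁ Φ) ^ 2 = Del c₁ c₂ σ₀ σ₁ Φ :=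
    Real.sq_sqrt (by unfold Del; positivity)
  have hs_lt : √(Del c₁ c₂ σ₀ σ₁ Φ) < aa c₁ σ₀ Φ + bb c₂ σ₁ Φ := by
    rw [Real.sqrt_lt' (by positivity), Del]
    linarith
  have hl1 : 0 < lam1 c₁ c₂ σ₀ σ₁ Φ := Real.sqrt_pos.2 (by linarith)
  have hl2 : 0 < lam2 c₁ c₂ σ₀ σ₁ Φ := Real.sqrt_pos.2 hb
  have hl3 : 0 < lam3 c₁ c₂ σ₀ σ₁ Φ := Real.sqrt_pos.2 (by linarith)
  have hl1sq : lam1 c₁ c₂ σ₀ σ₁ Φ ^ 2 =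
      (aa c₁ σ₀ Φ + bb c₂ σ₁ Φ) / 2 + √(Del c₁ c₂ σ₀ σ₁ Φ) / 2 :=
    Real.sq_sqrt (by linarith)
  have hl3sq : lam3 c₁ c₂ σ₀ σ₁ Φ ^ 2 =
      (aa c₁ σ₀ Φ + bb c₂ σ₁ Φ) / 2 - √(Del c₁ c₂ σ₀ σ₁ Φ) / 2 :=
    Real.sq_sqrt (by linarith)
  have hDel : Del c₁ c₂ σ₀ σ₁ Φ = (aa c₁ σ₀ Φ - bb c₂ σ₁ Φ) ^ 2 +
      16 * σ₁ ^ 2 * (Φ 1 ^ 2 + Φ 2 ^ 2) := by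
    simp only [Del, cc, dd]; ring
  obtain ⟨p, hp⟩ : ∃ p, p = (lam1 c₁ c₂ σ₀ σ₁ Φ ^ 2 - bb c₂ σ₁ Φ) / (2 * σ₁) := ⟨_, rfl⟩
  obtain ⟨q, hq⟩ : ∃ q, q = (lam3 c₁ c₂ σ₀ σ₁ Φ ^ 2 - bb c₂ σ₁ Φ) / (2 * σ₁) := ⟨_, rfl⟩
  have hK : Kc c₁ c₂ σ₀ σ₁ Φ = 2 * (p * p + Φ 1 * Φ 1 + Φ 2 * Φ 2) := by
    rw [hp, hl1sq, Kc]
    field_simp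
    linear_combination 4 * hDel - 4 * hs2
  have hN : Nc c₁ c₂ σ₀ σ₁ Φ = 2 * (q * q + Φ 1 * Φ 1 + Φ 2 * Φ 2) := by
    rw [hq, hl3sq, Nc]
    field_simp
    linear_combination 4 * hDel - 4 * hs2
  have hM : Mc Φ = 2 * (Φ 2 * Φ 2 + Φ 1 * Φ 1) := by rw [Mc]; ring
  have hpq : p * q + Φ 1 * Φ 1 + Φ 2 * Φ 2 = 0 := by
    rw [hp, hq, hl1sq, hl3sq]
    field_simp
    linear_combination -hDel - hs2
  have hK0 : Kc c₁ c₂ σ₀ σ₁ Φ ≠ 0 := by rw [hK]; nlinarith [mul_self_nonneg p]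
  have hM0 : Mc Φ ≠ 0 := by rw [hM]; nlinarith
  have hN0 : Nc c₁ c₂ σ₀ σ₁ Φ ≠ 0 := by rw [hN]; nlinarith [mul_self_nonneg q]
  refine ⟨hK0, hM0, hN0, ?_⟩
  have hr1 := r1_eq_stacked c₁ c₂ σ₀ σ₁ Φ
  have hl1' := l1_eq_smul_stacked c₁ c₂ σ₀ σ₁ Φ
  rw [← hp] at hr1 hl1'
  have hr2 := r2_eq_stacked c₁ c₂ σ₀ σ₁ Φ
  have hl2' := l2_eq_smul_stacked c₁ c₂ σ₀ σ₁ Φ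
  have hr3 := r3_eq_stacked c₁ c₂ σ₀ σ₁ Φ
  have hl3' := l3_eq_smul_stacked c₁ c₂ σ₀ σ₁ Φ
  rw [← hq] at hr3 hl3'
  have hr4 := r4_eq_stacked c₁ c₂ σ₀ σ₁ Φ
  have hl4' := l4_eq_smul_stacked c₁ c₂ σ₀ σ₁ Φ
  rw [← hq] at hr4 hl4'
  have hr5 := r5_eq_stacked c₁ c₂ σ₀ σ₁ Φ
  have hl5' := l5_eq_smul_stacked c₁ c₂ σ₀ σ₁ Φ
  have hr6 := r6_eq_stacked c₁ c₂ σ₀ σ₁ Φ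
  have hl6' := l6_eq_smul_stacked c₁ c₂ σ₀ σ₁ Φ
  rw [← hp] at hr6 hl6'
  have hqp : q * p + Φ 1 * Φ 1 + Φ 2 * Φ 2 = 0 := by rw [mul_comm q]; exact hpq
  have hKinv : (Kc c₁ c₂ σ₀ σ₁ Φ)⁻¹ * ((1 + 1) * (p * p + Φ 1 * Φ 1 + Φ 2 * Φ 2)) = 1 := by
    rw [one_add_one_eq_two, ← hK, inv_mul_cancel₀ hK0]
  have hMinv : (Mc Φ)⁻¹ * ((1 + 1) * (Φ 2 * Φ 2 + Φ 1 * Φ 1)) = 1 := by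
    rw [one_add_one_eq_two, ← hM, inv_mul_cancel₀ hM0]
  have hNinv : (Nc c₁ c₂ σ₀ σ₁ Φ)⁻¹ * ((1 + 1) * (q * q + Φ 1 * Φ 1 + Φ 2 * Φ 2)) = 1 := by
    rw [one_add_one_eq_two, ← hN, inv_mul_cancel₀ hN0]
  intro i j
  fin_cases i <;> fin_cases j <;>
    simp [lvK, rvK, hr1, hr2, hr3, hr4, hr5, hr6, hl1', hl2', hl3', hl4', hl5', hl6',
      stacked_dotProduct_stacked, hl1.ne', hl2.ne', hl3.ne', hpq, hqp,
      mul_comm (Φ 2) (Φ 1), hKinv, hMinv, hNinv]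
end
end

section
/- Genuine nonlinearity and linear degeneracy (Lemma 3.1): There exists δ > 0 such that for every Φ ∈ ℝ⁶ with |Φ| < 2δ: (i) ∇λ₂(Φ)·r₂(Φ) = 0 and ∇λ₅(Φ)·r₅(Φ) = 0 (the 2nd and 5th characteristic fields are linearly degenerate); (ii) ∇λ₁(Φ)·r₁(Φ) = −∇λ₆(Φ)·r₆(Φ) = (2σ₀(a−b)(λ₁²−b) + (2σ₀+6σ₁)(c²+d²)) / (4σ₁λ₁√Δ), and this quantity is nonzero (the 1st and 6th characteristic fields are genuinely nonlinear); (iii) at Φ = 0, ∇λ₁(0)·r₁(0) = σ₀(c₁²−c₂²)/(2σ₁c₁). -/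
set_option linter.unusedVariables false

noncomputable section

open Real Matrix

lemma hasFDerivAt_aa (c₁ σ₀ : ℝ) (Φ : Fin 6 → ℝ) :
    HasFDerivAt (aa c₁ σ₀) ((2 * σ₀) • ContinuousLinearMap.proj (R := ℝ) (φ := fun _ => ℝ) 0) Φ :=
  ((hasFDerivAt_apply (𝕜 := ℝ) (0 : Fin 6) Φ).const_mul (2 * σ₀)).const_add (c₁ ^ 2)

lemma hasFDerivAt_bb (c₂ σ₁ : ℝ) (Φ : Fin 6 → ℝ) :
    HasFDerivAt (bb c₂ σ₁) ((2 * σ₁) • ContinuousLinearMap.proj (R := ℝ) (φ := fun _ => ℝ) 0) Φ :=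
  hasFDerivAt_aa c₂ σ₁ Φ

lemma hasFDerivAt_cc (σ₁ : ℝ) (Φ : Fin 6 → ℝ) :
    HasFDerivAt (cc σ₁) ((2 * σ₁) • ContinuousLinearMap.proj (R := ℝ) (φ := fun _ => ℝ) 1) Φ :=
  (hasFDerivAt_apply (𝕜 := ℝ) (1 : Fin 6) Φ).const_mul (2 * σ₁)

lemma hasFDerivAt_dd (σ₁ : ℝ) (Φ : Fin 6 → ℝ) :
    HasFDerivAt (dd σ₁) ((2 * σ₁) • ContinuousLinearMap.proj (R := ℝ) (φ := fun _ => ℝ) 2) Φ :=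
  (hasFDerivAt_apply (𝕜 := ℝ) (2 : Fin 6) Φ).const_mul (2 * σ₁)

lemma fderiv_lam2_apply (c₁ c₂ σ₀ σ₁ : ℝ) {Φ : Fin 6 → ℝ} (hb : 0 < bb c₂ σ₁ Φ)
    (v : Fin 6 → ℝ) :
    fderiv ℝ (lam2 c₁ c₂ σ₀ σ₁) Φ v = σ₁ * v 0 / lam2 c₁ c₂ σ₀ σ₁ Φ := by
  have h : HasFDerivAt (lam2 c₁ c₂ σ₀ σ₁) _ Φ := (hasFDerivAt_bb c₂ σ₁ Φ).sqrt hb.ne'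
  have hs : √(bb c₂ σ₁ Φ) ≠ 0 := (Real.sqrt_pos.2 hb).ne'
  rw [h.fderiv]
  simp only [_root_.smul_apply, ContinuousLinearMap.proj_apply, smul_eq_mul, lam2]
  field_simp

lemma fderiv_lam1_apply (c₁ c₂ σ₀ σ₁ : ℝ) {Φ : Fin 6 → ℝ} (hD : 0 < Del c₁ c₂ σ₀ σ₁ Φ)
    (hL : 0 < (aa c₁ σ₀ Φ + bb c₂ σ₁ Φ) / 2 + √(Del c₁ c₂ σ₀ σ₁ Φ) / 2) (v : Fin 6 → ℝ) :
    fderiv ℝ (lam1 c₁ c₂ σ₀ σ₁) Φ v =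
      ((σ₀ + σ₁) * v 0 +
        ((aa c₁ σ₀ Φ - bb c₂ σ₁ Φ) * (σ₀ - σ₁) * v 0 +
          4 * σ₁ * (cc σ₁ Φ * v 1 + dd σ₁ Φ * v 2)) / √(Del c₁ c₂ σ₀ σ₁ Φ)) /
      (2 * lam1 c₁ c₂ σ₀ σ₁ Φ) := by
  have ha := hasFDerivAt_aa c₁ σ₀ Φ
  have hb := hasFDerivAt_bb c₂ σ₁ Φ
  have hΔ : HasFDerivAt (Del c₁ c₂ σ₀ σ₁) _ Φ := ((ha.sub hb).pow 2).add
    ((((hasFDerivAt_cc σ₁ Φ).pow 2).add ((hasFDerivAt_dd σ₁ Φ).pow 2)).const_mul 4)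
  have h : HasFDerivAt (lam1 c₁ c₂ σ₀ σ₁) _ Φ :=
    (((ha.add hb).mul_const (2⁻¹ : ℝ)).add ((hΔ.sqrt hD.ne').mul_const (2⁻¹ : ℝ))).sqrt hL.ne'
  have hs : √(Del c₁ c₂ σ₀ σ₁ Φ) ≠ 0 := (Real.sqrt_pos.2 hD).ne'
  have hl : lam1 c₁ c₂ σ₀ σ₁ Φ ≠ 0 := (Real.sqrt_pos.2 hL).ne'
  rw [h.fderiv]
  change (1 / (2 * lam1 c₁ c₂ σ₀ σ₁ Φ)) * _ = _
  simp
  field_simp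

/-- The numerator of `∇λ₁ · r₁`. -/
def genuineNum (c₁ c₂ σ₀ σ₁ : ℝ) (Φ : Fin 6 → ℝ) : ℝ :=
  2 * σ₀ * (aa c₁ σ₀ Φ - bb c₂ σ₁ Φ) * ((lam1 c₁ c₂ σ₀ σ₁ Φ) ^ 2 - bb c₂ σ₁ Φ)
    + (2 * σ₀ + 6 * σ₁) * ((cc σ₁ Φ) ^ 2 + (dd σ₁ Φ) ^ 2)

lemma fderiv_lam1_r1 (c₁ c₂ σ₀ : ℝ) {σ₁ : ℝ} (hσ1 : σ₁ ≠ 0) {Φ : Fin 6 → ℝ}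
    (hD : 0 < Del c₁ c₂ σ₀ σ₁ Φ)
    (hL : 0 < (aa c₁ σ₀ Φ + bb c₂ σ₁ Φ) / 2 + √(Del c₁ c₂ σ₀ σ₁ Φ) / 2) :
    fderiv ℝ (lam1 c₁ c₂ σ₀ σ₁) Φ (r1 c₁ c₂ σ₀ σ₁ Φ) =
      genuineNum c₁ c₂ σ₀ σ₁ Φ /
        (4 * σ₁ * lam1 c₁ c₂ σ₀ σ₁ Φ * √(Del c₁ c₂ σ₀ σ₁ Φ)) := by
  have hs : √(Del c₁ c₂ σ₀ σ₁ Φ) ≠ 0 := (Real.sqrt_pos.2 hD).ne'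
  have hl : lam1 c₁ c₂ σ₀ σ₁ Φ ≠ 0 := (Real.sqrt_pos.2 hL).ne'
  have hl2 : lam1 c₁ c₂ σ₀ σ₁ Φ ^ 2 =
      (aa c₁ σ₀ Φ + bb c₂ σ₁ Φ) / 2 + √(Del c₁ c₂ σ₀ σ₁ Φ) / 2 := Real.sq_sqrt hL.le
  have hs2 : √(Del c₁ c₂ σ₀ σ₁ Φ) ^ 2 = (aa c₁ σ₀ Φ - bb c₂ σ₁ Φ) ^ 2 +
      4 * ((cc σ₁ Φ) ^ 2 + (dd σ₁ Φ) ^ 2) := Real.sq_sqrt hD.le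
  have h0 : r1 c₁ c₂ σ₀ σ₁ Φ 0 = (lam1 c₁ c₂ σ₀ σ₁ Φ ^ 2 - bb c₂ σ₁ Φ) / (2 * σ₁) := rfl
  have h1 : r1 c₁ c₂ σ₀ σ₁ Φ 1 = cc σ₁ Φ / (2 * σ₁) := by
    rw [cc]; field_simp; rfl
  have h2 : r1 c₁ c₂ σ₀ σ₁ Φ 2 = dd σ₁ Φ / (2 * σ₁) := by
    rw [dd]; field_simp; rfl
  rw [fderiv_lam1_apply c₁ c₂ σ₀ σ₁ hD hL, h0, h1, h2, genuineNum, hl2]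
  generalize √(Del c₁ c₂ σ₀ σ₁ Φ) = s at *
  field_simp
  linear_combination 4 * (σ₀ + σ₁) * hs2

lemma fderiv_lam6_r6 (c₁ c₂ σ₀ σ₁ : ℝ) {Φ : Fin 6 → ℝ} (hD : 0 < Del c₁ c₂ σ₀ σ₁ Φ)
    (hL : 0 < (aa c₁ σ₀ Φ + bb c₂ σ₁ Φ) / 2 + √(Del c₁ c₂ σ₀ σ₁ Φ) / 2) :
    fderiv ℝ (lam6 c₁ c₂ σ₀ σ₁) Φ (r6 c₁ c₂ σ₀ σ₁ Φ) =
      -fderiv ℝ (lam1 c₁ c₂ σ₀ σ₁) Φ (r1 c₁ c₂ σ₀ σ₁ Φ) := by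
  have h : fderiv ℝ (lam6 c₁ c₂ σ₀ σ₁) Φ = -fderiv ℝ (lam1 c₁ c₂ σ₀ σ₁) Φ := fderiv_neg
  rw [h, _root_.neg_apply, fderiv_lam1_apply c₁ c₂ σ₀ σ₁ hD hL,
    fderiv_lam1_apply c₁ c₂ σ₀ σ₁ hD hL]
  rfl

lemma continuous_Del (c₁ c₂ σ₀ σ₁ : ℝ) : Continuous (Del c₁ c₂ σ₀ σ₁) := by
  unfold Del aa bb cc dd
  fun_prop

lemma continuous_genuineNum (c₁ c₂ σ₀ σ₁ : ℝ) : Continuous (genuineNum c₁ c₂ σ₀ σ₁) := by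
  unfold genuineNum lam1 Del aa bb cc dd
  fun_prop

lemma sqrt_Del_zero {c₁ c₂ : ℝ} (σ₀ σ₁ : ℝ) (h : 0 ≤ c₁ ^ 2 - c₂ ^ 2) :
    √(Del c₁ c₂ σ₀ σ₁ 0) = c₁ ^ 2 - c₂ ^ 2 := by
  simp [Del, aa, bb, cc, dd, Real.sqrt_sq h]

lemma lam1_zero {c₁ c₂ : ℝ} (σ₀ σ₁ : ℝ) (hc₁ : 0 ≤ c₁) (h : 0 ≤ c₁ ^ 2 - c₂ ^ 2) :
    lam1 c₁ c₂ σ₀ σ₁ 0 = c₁ := by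
  rw [lam1, sqrt_Del_zero σ₀ σ₁ h, ← Real.sqrt_sq hc₁]
  congr 1
  simp [aa, bb, Real.sqrt_sq hc₁]
  ring

lemma genuineNum_zero {c₁ c₂ : ℝ} (σ₀ σ₁ : ℝ) (hc₁ : 0 ≤ c₁) (h : 0 ≤ c₁ ^ 2 - c₂ ^ 2) :
    genuineNum c₁ c₂ σ₀ σ₁ 0 = 2 * σ₀ * (c₁ ^ 2 - c₂ ^ 2) ^ 2 := by
  rw [genuineNum, lam1_zero σ₀ σ₁ hc₁ h]
  simp [aa, bb, cc, dd]
  ring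

/-- **Genuine nonlinearity and linear degeneracy** (Lemma 3.1).
`∇λ_i(Φ)·r_j(Φ)` is expressed as the directional derivative `cC i j Φ`
(with 0-based indices: paper index `p` corresponds to `p−1`). -/
theorem genuine_nonlinearity_and_degeneracy (c₁ c₂ σ₀ σ₁ : ℝ) (hc : c₂ < c₁) (hc2 : 0 < c₂)
    (hσ0 : σ₀ ≠ 0) (hσ1 : σ₁ ≠ 0) :
    ∃ δ > (0 : ℝ),
      (∀ Φ : Fin 6 → ℝ, ‖Φ‖ < 2 * δ →
        -- (i) linear degeneracy of the 2nd and 5th characteristic fields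
        (cC c₁ c₂ σ₀ σ₁ 1 1 Φ = 0 ∧ cC c₁ c₂ σ₀ σ₁ 4 4 Φ = 0) ∧
        -- (ii) genuine nonlinearity of the 1st and 6th characteristic fields
        (cC c₁ c₂ σ₀ σ₁ 0 0 Φ = -cC c₁ c₂ σ₀ σ₁ 5 5 Φ ∧
          cC c₁ c₂ σ₀ σ₁ 0 0 Φ =
            (2 * σ₀ * (aa c₁ σ₀ Φ - bb c₂ σ₁ Φ) * ((lam1 c₁ c₂ σ₀ σ₁ Φ) ^ 2 - bb c₂ σ₁ Φ)
              + (2 * σ₀ + 6 * σ₁) * ((cc σ₁ Φ) ^ 2 + (dd σ₁ Φ) ^ 2)) /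
            (4 * σ₁ * lam1 c₁ c₂ σ₀ σ₁ Φ * Real.sqrt (Del c₁ c₂ σ₀ σ₁ Φ)) ∧
          cC c₁ c₂ σ₀ σ₁ 0 0 Φ ≠ 0)) ∧
      -- (iii) value at `Φ = 0`
      cC c₁ c₂ σ₀ σ₁ 0 0 (0 : Fin 6 → ℝ) = σ₀ * (c₁ ^ 2 - c₂ ^ 2) / (2 * σ₁ * c₁) := by
  have hc₁ : 0 < c₁ := hc2.trans hc
  have hcc : 0 < c₁ ^ 2 - c₂ ^ 2 := by nlinarith
  have hΔ0 := sqrt_Del_zero σ₀ σ₁ hcc.le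
  have hl0 := lam1_zero σ₀ σ₁ hc₁.le hcc.le
  have hN0 := genuineNum_zero σ₀ σ₁ hc₁.le hcc.le
  have hb : ∀ᶠ Φ in nhds (0 : Fin 6 → ℝ), 0 < bb c₂ σ₁ Φ := by
    refine (hasFDerivAt_bb c₂ σ₁ 0).continuousAt.eventually (lt_mem_nhds ?_)
    rw [bb, Pi.zero_apply, mul_zero, add_zero]
    positivity
  have hD : ∀ᶠ Φ in nhds (0 : Fin 6 → ℝ), 0 < Del c₁ c₂ σ₀ σ₁ Φ :=
    (continuous_Del c₁ c₂ σ₀ σ₁).continuousAt.eventually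
      (lt_mem_nhds (Real.sqrt_pos.1 (hΔ0 ▸ hcc)))
  have ha : ∀ᶠ Φ in nhds (0 : Fin 6 → ℝ), 0 < aa c₁ σ₀ Φ := by
    refine (hasFDerivAt_aa c₁ σ₀ 0).continuousAt.eventually (lt_mem_nhds ?_)
    rw [aa, Pi.zero_apply, mul_zero, add_zero]
    positivity
  have hN : ∀ᶠ Φ in nhds (0 : Fin 6 → ℝ), genuineNum c₁ c₂ σ₀ σ₁ Φ ≠ 0 := by
    refine (continuous_genuineNum c₁ c₂ σ₀ σ₁).continuousAt.eventually_ne ?_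
    rw [hN0]
    exact mul_ne_zero (mul_ne_zero two_ne_zero hσ0) (pow_ne_zero 2 hcc.ne')
  obtain ⟨ε, hε, H⟩ := Metric.eventually_nhds_iff.1 (hb.and (hD.and (ha.and hN)))
  refine ⟨ε / 2, half_pos hε, fun Φ hΦ => ?_, ?_⟩
  · obtain ⟨hb, hD, ha, hN⟩ := H (y := Φ) (by rw [dist_zero_right]; linarith)
    have hs : 0 < √(Del c₁ c₂ σ₀ σ₁ Φ) := Real.sqrt_pos.2 hD
    have hL : 0 < (aa c₁ σ₀ Φ + bb c₂ σ₁ Φ) / 2 + √(Del c₁ c₂ σ₀ σ₁ Φ) / 2 := by positivity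
    have hl : 0 < lam1 c₁ c₂ σ₀ σ₁ Φ := Real.sqrt_pos.2 hL
    have h11 : cC c₁ c₂ σ₀ σ₁ 0 0 Φ = _ := fderiv_lam1_r1 c₁ c₂ σ₀ hσ1 hD hL
    have h66 : cC c₁ c₂ σ₀ σ₁ 5 5 Φ = -cC c₁ c₂ σ₀ σ₁ 0 0 Φ :=
      fderiv_lam6_r6 c₁ c₂ σ₀ σ₁ hD hL
    refine ⟨⟨?_, ?_⟩, by rw [h66, neg_neg], h11, ?_⟩
    · change fderiv ℝ (lam2 c₁ c₂ σ₀ σ₁) Φ (r2 c₁ c₂ σ₀ σ₁ Φ) = 0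
      simp [fderiv_lam2_apply c₁ c₂ σ₀ σ₁ hb, r2]
    · have h : fderiv ℝ (lam5 c₁ c₂ σ₀ σ₁) Φ = -fderiv ℝ (lam2 c₁ c₂ σ₀ σ₁) Φ := fderiv_neg
      change fderiv ℝ (lam5 c₁ c₂ σ₀ σ₁) Φ (r5 c₁ c₂ σ₀ σ₁ Φ) = 0
      simp [h, fderiv_lam2_apply c₁ c₂ σ₀ σ₁ hb, r5]
    · rw [h11]
      exact div_ne_zero hN (by positivity)
  · obtain ⟨hb, hD, ha, -⟩ := H (y := 0) (by simpa using hε)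
    have h11 : cC c₁ c₂ σ₀ σ₁ 0 0 0 = _ := fderiv_lam1_r1 c₁ c₂ σ₀ hσ1 hD (by positivity)
    rw [h11, hN0, hl0, hΔ0]
    field_simp
    ring
end
end

section
/- Directional derivatives of the right eigenvector fields (formulas (3.23) and (3.26)): There exists δ > 0 such that for every Φ ∈ ℝ⁶ with |Φ| < 2δ: Dr₂(Φ)[r₃(Φ)] = (0, φ₃, −φ₂, 0, −λ₂φ₃ − φ₃(λ₃²−b)/(2λ₂), λ₂φ₂ + φ₂(λ₃²−b)/(2λ₂)), Dr₃(Φ)[r₂(Φ)] = (0, φ₃, −φ₂, 0, −λ₃φ₃, λ₃φ₂), Dr₄(Φ)[r₅(Φ)] = (0, φ₃, −φ₂, 0, λ₃φ₃, −λ₃φ₂), and Dr₅(Φ)[r₄(Φ)] = (0, φ₃, −φ₂, 0, λ₂φ₃ + φ₃(λ₃²−b)/(2λ₂), −λ₂φ₂ − φ₂(λ₃²−b)/(2λ₂)). -/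
set_option linter.unusedVariables false

noncomputable section

open Real Matrix

section DirectionalDerivatives

variable {c₁ c₂ σ₀ σ₁ : ℝ} {Φ v w : Fin 6 → ℝ}

/-- The directional derivative of a differentiable map into `Fin 6 → ℝ` may be computed
componentwise along the line in the given direction. -/
lemma fderiv_apply_eq_of_hasDerivAt {f : (Fin 6 → ℝ) → Fin 6 → ℝ} (hf : DifferentiableAt ℝ f Φ)
    (h : ∀ i, HasDerivAt (fun t : ℝ => f (Φ + t • v) i) (w i) 0) : fderiv ℝ f Φ v = w := by
  rw [← hf.lineDeriv_eq_fderiv]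
  exact HasLineDerivAt.lineDeriv (hasDerivAt_pi.2 h)

lemma hasDerivAt_line_apply (Φ v : Fin 6 → ℝ) (i : Fin 6) :
    HasDerivAt (fun t : ℝ => (Φ + t • v) i) (v i) 0 := by
  simpa using ((hasDerivAt_id (0 : ℝ)).mul_const (v i)).const_add (Φ i)

lemma differentiableAt_lam2 (hb : 0 < bb c₂ σ₁ Φ) :
    DifferentiableAt ℝ (lam2 c₁ c₂ σ₀ σ₁) Φ := by
  have : DifferentiableAt ℝ (bb c₂ σ₁) Φ := by unfold bb; fun_prop
  exact this.sqrt hb.ne'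

lemma differentiable_Del : Differentiable ℝ (Del c₁ c₂ σ₀ σ₁) := by
  unfold Del aa bb cc dd; fun_prop

lemma differentiableAt_lam3 (hD : 0 < Del c₁ c₂ σ₀ σ₁ Φ)
    (hl : 0 < (aa c₁ σ₀ Φ + bb c₂ σ₁ Φ) / 2 - √(Del c₁ c₂ σ₀ σ₁ Φ) / 2) :
    DifferentiableAt ℝ (lam3 c₁ c₂ σ₀ σ₁) Φ := by
  have h1 : DifferentiableAt ℝ (fun Ψ => √(Del c₁ c₂ σ₀ σ₁ Ψ)) Φ :=
    (differentiable_Del Φ).sqrt hD.ne'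
  have h2 : DifferentiableAt ℝ (fun Ψ => (aa c₁ σ₀ Ψ + bb c₂ σ₁ Ψ) / 2) Φ := by
    unfold aa bb; fun_prop
  have h3 : DifferentiableAt ℝ (fun Ψ => (aa c₁ σ₀ Ψ + bb c₂ σ₁ Ψ) / 2
      - √(Del c₁ c₂ σ₀ σ₁ Ψ) / 2) Φ := by fun_prop
  exact h3.sqrt hl.ne'

lemma hasDerivAt_lam2_line (hb : 0 < bb c₂ σ₁ Φ) (v : Fin 6 → ℝ) :
    HasDerivAt (fun t : ℝ => lam2 c₁ c₂ σ₀ σ₁ (Φ + t • v))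
      (σ₁ * v 0 / lam2 c₁ c₂ σ₀ σ₁ Φ) 0 := by
  have h : HasDerivAt (fun t : ℝ => bb c₂ σ₁ (Φ + t • v)) (2 * σ₁ * v 0) 0 :=
    ((hasDerivAt_line_apply Φ v 0).const_mul (2 * σ₁)).const_add (c₂ ^ 2)
  refine (h.sqrt (by simpa using hb.ne')).congr_deriv ?_
  rw [zero_smul, add_zero, mul_assoc, mul_div_mul_left _ _ two_ne_zero, lam2]

/-- `λ₃` is stationary in every direction tangent to the circles
`φ₁ = const`, `φ₂² + φ₃² = const`. -/
lemma hasDerivAt_lam3_line_of_tangent (hD : 0 < Del c₁ c₂ σ₀ σ₁ Φ)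
    (hl : 0 < (aa c₁ σ₀ Φ + bb c₂ σ₁ Φ) / 2 - √(Del c₁ c₂ σ₀ σ₁ Φ) / 2)
    (hv : v 0 = 0) (hv' : Φ 1 * v 1 + Φ 2 * v 2 = 0) :
    HasDerivAt (fun t : ℝ => lam3 c₁ c₂ σ₀ σ₁ (Φ + t • v)) 0 0 := by
  have h0 := hasDerivAt_line_apply Φ v 0
  have ha : HasDerivAt (fun t : ℝ => aa c₁ σ₀ (Φ + t • v)) 0 0 := by
    simpa [aa, hv] using (h0.const_mul (2 * σ₀)).const_add (c₁ ^ 2)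
  have hb : HasDerivAt (fun t : ℝ => bb c₂ σ₁ (Φ + t • v)) 0 0 := by
    simpa [bb, hv] using (h0.const_mul (2 * σ₁)).const_add (c₂ ^ 2)
  have hc : HasDerivAt (fun t : ℝ => cc σ₁ (Φ + t • v)) (2 * σ₁ * v 1) 0 :=
    (hasDerivAt_line_apply Φ v 1).const_mul (2 * σ₁)
  have hd : HasDerivAt (fun t : ℝ => dd σ₁ (Φ + t • v)) (2 * σ₁ * v 2) 0 :=
    (hasDerivAt_line_apply Φ v 2).const_mul (2 * σ₁)
  have hDel : HasDerivAt (fun t : ℝ => Del c₁ c₂ σ₀ σ₁ (Φ + t • v)) 0 0 := by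
    refine (((ha.sub hb).pow 2).add (((hc.pow 2).add (hd.pow 2)).const_mul 4)).congr_deriv ?_
    simp [cc, dd]
    linear_combination (8 * σ₁ ^ 2) * hv'
  exact ((((ha.add hb).div_const 2).sub
    ((hDel.sqrt (by simpa using hD.ne')).div_const 2)).sqrt (by simpa using hl.ne')).congr_deriv
      (by simp)

lemma differentiableAt_r2 (hb : 0 < bb c₂ σ₁ Φ) : DifferentiableAt ℝ (r2 c₁ c₂ σ₀ σ₁) Φ := by
  have := differentiableAt_lam2 (c₁ := c₁) (σ₀ := σ₀) hb
  refine differentiableAt_pi.2 fun i => ?_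
  fin_cases i <;> simp [r2] <;> fun_prop

lemma differentiableAt_r5 (hb : 0 < bb c₂ σ₁ Φ) : DifferentiableAt ℝ (r5 c₁ c₂ σ₀ σ₁) Φ := by
  have := differentiableAt_lam2 (c₁ := c₁) (σ₀ := σ₀) hb
  refine differentiableAt_pi.2 fun i => ?_
  fin_cases i <;> simp [r5] <;> fun_prop

lemma differentiableAt_r3 (h : DifferentiableAt ℝ (lam3 c₁ c₂ σ₀ σ₁) Φ) :
    DifferentiableAt ℝ (r3 c₁ c₂ σ₀ σ₁) Φ := by
  refine differentiableAt_pi.2 fun i => ?_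
  fin_cases i <;> simp [r3, bb] <;> fun_prop

lemma differentiableAt_r4 (h : DifferentiableAt ℝ (lam3 c₁ c₂ σ₀ σ₁) Φ) :
    DifferentiableAt ℝ (r4 c₁ c₂ σ₀ σ₁) Φ := by
  refine differentiableAt_pi.2 fun i => ?_
  fin_cases i <;> simp [r4, bb] <;> fun_prop

lemma fderiv_r2_apply (hb : 0 < bb c₂ σ₁ Φ) (v : Fin 6 → ℝ) :
    fderiv ℝ (r2 c₁ c₂ σ₀ σ₁) Φ v =
      ![0, v 2, -v 1, 0,
        -(σ₁ * v 0 / lam2 c₁ c₂ σ₀ σ₁ Φ * Φ 2 + lam2 c₁ c₂ σ₀ σ₁ Φ * v 2),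
        σ₁ * v 0 / lam2 c₁ c₂ σ₀ σ₁ Φ * Φ 1 + lam2 c₁ c₂ σ₀ σ₁ Φ * v 1] := by
  have hL := hasDerivAt_lam2_line (c₁ := c₁) (σ₀ := σ₀) hb v
  have h1 := hasDerivAt_line_apply Φ v 1
  have h2 := hasDerivAt_line_apply Φ v 2
  refine fderiv_apply_eq_of_hasDerivAt (differentiableAt_r2 hb) fun i => ?_
  fin_cases i
  · exact hasDerivAt_const _ _
  · exact h2
  · exact h1.neg
  · exact hasDerivAt_const _ _
  · exact (hL.neg.mul h2).congr_deriv (by simp; ring)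
  · exact (hL.mul h1).congr_deriv (by simp)

lemma fderiv_r5_apply (hb : 0 < bb c₂ σ₁ Φ) (v : Fin 6 → ℝ) :
    fderiv ℝ (r5 c₁ c₂ σ₀ σ₁) Φ v =
      ![0, v 2, -v 1, 0,
        σ₁ * v 0 / lam2 c₁ c₂ σ₀ σ₁ Φ * Φ 2 + lam2 c₁ c₂ σ₀ σ₁ Φ * v 2,
        -(σ₁ * v 0 / lam2 c₁ c₂ σ₀ σ₁ Φ * Φ 1 + lam2 c₁ c₂ σ₀ σ₁ Φ * v 1)] := by
  have hL := hasDerivAt_lam2_line (c₁ := c₁) (σ₀ := σ₀) hb v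
  have h1 := hasDerivAt_line_apply Φ v 1
  have h2 := hasDerivAt_line_apply Φ v 2
  refine fderiv_apply_eq_of_hasDerivAt (differentiableAt_r5 hb) fun i => ?_
  fin_cases i
  · exact hasDerivAt_const _ _
  · exact h2
  · exact h1.neg
  · exact hasDerivAt_const _ _
  · exact (hL.mul h2).congr_deriv (by simp)
  · exact (hL.neg.mul h1).congr_deriv (by simp; ring)

lemma fderiv_r3_apply_of_tangent (hD : 0 < Del c₁ c₂ σ₀ σ₁ Φ)
    (hl : 0 < (aa c₁ σ₀ Φ + bb c₂ σ₁ Φ) / 2 - √(Del c₁ c₂ σ₀ σ₁ Φ) / 2)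
    (hv : v 0 = 0) (hv' : Φ 1 * v 1 + Φ 2 * v 2 = 0) :
    fderiv ℝ (r3 c₁ c₂ σ₀ σ₁) Φ v =
      ![0, v 1, v 2, 0, -(lam3 c₁ c₂ σ₀ σ₁ Φ) * v 1, -(lam3 c₁ c₂ σ₀ σ₁ Φ) * v 2] := by
  have hL := hasDerivAt_lam3_line_of_tangent hD hl hv hv'
  have h1 := hasDerivAt_line_apply Φ v 1
  have h2 := hasDerivAt_line_apply Φ v 2
  have hb : HasDerivAt (fun t : ℝ => bb c₂ σ₁ (Φ + t • v)) 0 0 := by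
    simpa [bb, hv] using
      ((hasDerivAt_line_apply Φ v 0).const_mul (2 * σ₁)).const_add (c₂ ^ 2)
  have hS := (hL.pow 2).sub hb
  refine fderiv_apply_eq_of_hasDerivAt (differentiableAt_r3 (differentiableAt_lam3 hD hl))
    fun i => ?_
  fin_cases i
  · exact (hS.div_const (2 * σ₁)).congr_deriv (by simp)
  · exact h1
  · exact h2
  · exact ((hL.mul hS).neg.div_const (2 * σ₁)).congr_deriv (by simp)
  · exact (hL.neg.mul h1).congr_deriv (by simp)
  · exact (hL.neg.mul h2).congr_deriv (by simp)

lemma fderiv_r4_apply_of_tangent (hD : 0 < Del c₁ c₂ σ₀ σ₁ Φ)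
    (hl : 0 < (aa c₁ σ₀ Φ + bb c₂ σ₁ Φ) / 2 - √(Del c₁ c₂ σ₀ σ₁ Φ) / 2)
    (hv : v 0 = 0) (hv' : Φ 1 * v 1 + Φ 2 * v 2 = 0) :
    fderiv ℝ (r4 c₁ c₂ σ₀ σ₁) Φ v =
      ![0, v 1, v 2, 0, lam3 c₁ c₂ σ₀ σ₁ Φ * v 1, lam3 c₁ c₂ σ₀ σ₁ Φ * v 2] := by
  have hL := hasDerivAt_lam3_line_of_tangent hD hl hv hv'
  have h1 := hasDerivAt_line_apply Φ v 1
  have h2 := hasDerivAt_line_apply Φ v 2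
  have hb : HasDerivAt (fun t : ℝ => bb c₂ σ₁ (Φ + t • v)) 0 0 := by
    simpa [bb, hv] using
      ((hasDerivAt_line_apply Φ v 0).const_mul (2 * σ₁)).const_add (c₂ ^ 2)
  have hS := (hL.pow 2).sub hb
  refine fderiv_apply_eq_of_hasDerivAt (differentiableAt_r4 (differentiableAt_lam3 hD hl))
    fun i => ?_
  fin_cases i
  · exact (hS.div_const (2 * σ₁)).congr_deriv (by simp)
  · exact h1
  · exact h2
  · exact ((hL.mul hS).div_const (2 * σ₁)).congr_deriv (by simp)
  · exact (hL.mul h1).congr_deriv (by simp)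
  · exact (hL.mul h2).congr_deriv (by simp)

/-- All radicands are positive near the origin. -/
lemma eventually_radicands_pos (hc : c₂ < c₁) (hc2 : 0 < c₂) (σ₀ σ₁ : ℝ) :
    ∀ᶠ Φ in nhds (0 : Fin 6 → ℝ), 0 < bb c₂ σ₁ Φ ∧ 0 < Del c₁ c₂ σ₀ σ₁ Φ ∧
      0 < (aa c₁ σ₀ Φ + bb c₂ σ₁ Φ) / 2 - √(Del c₁ c₂ σ₀ σ₁ Φ) / 2 := by
  have hsq : 0 < c₁ ^ 2 - c₂ ^ 2 := by nlinarith
  have hb : Continuous (bb c₂ σ₁) := by unfold bb; fun_prop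
  have ha : Continuous (aa c₁ σ₀) := by unfold aa; fun_prop
  have hD : Continuous (Del c₁ c₂ σ₀ σ₁) := differentiable_Del.continuous
  have hl : Continuous fun Φ => (aa c₁ σ₀ Φ + bb c₂ σ₁ Φ) / 2 - √(Del c₁ c₂ σ₀ σ₁ Φ) / 2 := by
    fun_prop
  have hD0 : Del c₁ c₂ σ₀ σ₁ 0 = (c₁ ^ 2 - c₂ ^ 2) ^ 2 := by simp [Del, aa, bb, cc, dd]
  refine (hb.continuousAt.eventually_const_lt ?_).and
    ((hD.continuousAt.eventually_const_lt ?_).and (hl.continuousAt.eventually_const_lt ?_))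
  · simpa [bb] using pow_pos hc2 2
  · rw [hD0]; positivity
  · beta_reduce
    rw [hD0, Real.sqrt_sq hsq.le]
    simp only [aa, bb, Pi.zero_apply]
    nlinarith

end DirectionalDerivatives

/-- **Directional derivatives of the right eigenvector fields**
(formulas (3.23) and (3.26)). -/
theorem right_eigenvector_directional_derivatives (c₁ c₂ σ₀ σ₁ : ℝ)
    (hc : c₂ < c₁) (hc2 : 0 < c₂) (hσ0 : σ₀ ≠ 0) (hσ1 : σ₁ ≠ 0) :
    ∃ δ > (0 : ℝ), ∀ Φ : Fin 6 → ℝ, ‖Φ‖ < 2 * δ →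
      fderiv ℝ (r2 c₁ c₂ σ₀ σ₁) Φ (r3 c₁ c₂ σ₀ σ₁ Φ) =
        ![0, Φ 2, -Φ 1, 0,
          -(lam2 c₁ c₂ σ₀ σ₁ Φ) * Φ 2
            - Φ 2 * ((lam3 c₁ c₂ σ₀ σ₁ Φ) ^ 2 - bb c₂ σ₁ Φ) / (2 * lam2 c₁ c₂ σ₀ σ₁ Φ),
          lam2 c₁ c₂ σ₀ σ₁ Φ * Φ 1
            + Φ 1 * ((lam3 c₁ c₂ σ₀ σ₁ Φ) ^ 2 - bb c₂ σ₁ Φ) / (2 * lam2 c₁ c₂ σ₀ σ₁ Φ)] ∧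
      fderiv ℝ (r3 c₁ c₂ σ₀ σ₁) Φ (r2 c₁ c₂ σ₀ σ₁ Φ) =
        ![0, Φ 2, -Φ 1, 0,
          -(lam3 c₁ c₂ σ₀ σ₁ Φ) * Φ 2, lam3 c₁ c₂ σ₀ σ₁ Φ * Φ 1] ∧
      fderiv ℝ (r4 c₁ c₂ σ₀ σ₁) Φ (r5 c₁ c₂ σ₀ σ₁ Φ) =
        ![0, Φ 2, -Φ 1, 0,
          lam3 c₁ c₂ σ₀ σ₁ Φ * Φ 2, -(lam3 c₁ c₂ σ₀ σ₁ Φ) * Φ 1] ∧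
      fderiv ℝ (r5 c₁ c₂ σ₀ σ₁) Φ (r4 c₁ c₂ σ₀ σ₁ Φ) =
        ![0, Φ 2, -Φ 1, 0,
          lam2 c₁ c₂ σ₀ σ₁ Φ * Φ 2
            + Φ 2 * ((lam3 c₁ c₂ σ₀ σ₁ Φ) ^ 2 - bb c₂ σ₁ Φ) / (2 * lam2 c₁ c₂ σ₀ σ₁ Φ),
          -(lam2 c₁ c₂ σ₀ σ₁ Φ * Φ 1
            + Φ 1 * ((lam3 c₁ c₂ σ₀ σ₁ Φ) ^ 2 - bb c₂ σ₁ Φ) / (2 * lam2 c₁ c₂ σ₀ σ₁ Φ))] := by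
  obtain ⟨ε, hε, h⟩ := Metric.eventually_nhds_iff.1 (eventually_radicands_pos hc hc2 σ₀ σ₁)
  refine ⟨ε / 2, half_pos hε, fun Φ hΦ => ?_⟩
  obtain ⟨hb, hD, hl⟩ := @h Φ (by rw [dist_zero_right]; linarith)
  have hL : lam2 c₁ c₂ σ₀ σ₁ Φ ≠ 0 := (Real.sqrt_pos.2 hb).ne'
  refine ⟨?_, ?_, ?_, ?_⟩
  · rw [fderiv_r2_apply hb]
    ext i
    fin_cases i <;> simp [r3] <;> field_simp <;> ring
  · rw [fderiv_r3_apply_of_tangent hD hl (by simp [r2]) (by simp [r2]; ring)]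
    simp [r2]
  · rw [fderiv_r4_apply_of_tangent hD hl (by simp [r5]) (by simp [r5]; ring)]
    simp [r5]
  · rw [fderiv_r5_apply hb]
    ext i
    fin_cases i <;> simp [r4] <;> field_simp <;> ring
end
end

section
/- Vanishing interaction coefficients (Proposition 3.2, first part): There exists δ > 0 such that for every Φ ∈ ℝ⁶ with |Φ| < 2δ and (φ₂,φ₃) ≠ (0,0): γ₂₃¹(Φ) = 0, γ₃₂¹(Φ) = 0 and γ₄₅¹(Φ) + γ₅₄¹(Φ) = 0; c₃₂³(Φ) = 0, γ₃₂³(Φ) = 0 and γ₄₅³(Φ) = γ₅₄³(Φ) = 0; c₄₅⁴(Φ) = 0, γ₄₅⁴(Φ) = 0 and γ₂₃⁴(Φ) = γ₃₂⁴(Φ) = 0; γ₂₃⁶(Φ) = γ₃₂⁶(Φ) = 0 and γ₄₅⁶(Φ) = γ₅₄⁶(Φ) = 0. -/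
set_option linter.unusedVariables false

noncomputable section

open Real Matrix

/-- The vector `(0, xφ₃, -xφ₂, 0, yφ₃, -yφ₂)`, a pair of infinitesimal rotations of `(φ₂, φ₃)`. -/
def swirl (Φ : Fin 6 → ℝ) (x y : ℝ) : Fin 6 → ℝ :=
  ![0, x * Φ 2, -(x * Φ 1), 0, y * Φ 2, -(y * Φ 1)]

theorem swirl_sub (Φ : Fin 6 → ℝ) (x y x' y' : ℝ) :
    swirl Φ x y - swirl Φ x' y' = swirl Φ (x - x') (y - y') := by
  ext i
  fin_cases i <;> simp [swirl] <;> ring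

/-- The vector field `(s, φ₂, φ₃, t, μφ₂, μφ₃)`, the common form of `r₁, r₃, r₄, r₆`. -/
def radial (s t μ : (Fin 6 → ℝ) → ℝ) (Φ : Fin 6 → ℝ) : Fin 6 → ℝ :=
  ![s Φ, Φ 1, Φ 2, t Φ, μ Φ * Φ 1, μ Φ * Φ 2]

/-- A function of `φ₁` and `φ₂² + φ₃²` to first order at `Φ`: differentiable, with derivative
vanishing on `swirl` directions. -/
def RotInvariantAt (f : (Fin 6 → ℝ) → ℝ) (Φ : Fin 6 → ℝ) : Prop :=
  DifferentiableAt ℝ f Φ ∧ ∀ x y, fderiv ℝ f Φ (swirl Φ x y) = 0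

namespace RotInvariantAt

variable {f g : (Fin 6 → ℝ) → ℝ} {Φ : Fin 6 → ℝ}

theorem const (k : ℝ) : RotInvariantAt (fun _ => k) Φ := by
  simp [RotInvariantAt]

theorem apply_zero : RotInvariantAt (fun Ψ => Ψ 0) Φ := by
  refine ⟨by fun_prop, fun x y => ?_⟩
  rw [(hasFDerivAt_apply (𝕜 := ℝ) (0 : Fin 6) Φ).fderiv]
  simp [swirl]

theorem sq_add_sq : RotInvariantAt (fun Ψ => Ψ 1 ^ 2 + Ψ 2 ^ 2) Φ := by
  refine ⟨by fun_prop, fun x y => ?_⟩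
  have h := ((hasFDerivAt_apply (𝕜 := ℝ) (1 : Fin 6) Φ).pow 2).add
    ((hasFDerivAt_apply (𝕜 := ℝ) (2 : Fin 6) Φ).pow 2)
  rw [show fderiv ℝ (fun Ψ : Fin 6 → ℝ => Ψ 1 ^ 2 + Ψ 2 ^ 2) Φ = _ from h.fderiv]
  simp [swirl]
  ring

theorem add (hf : RotInvariantAt f Φ) (hg : RotInvariantAt g Φ) :
    RotInvariantAt (fun Ψ => f Ψ + g Ψ) Φ :=
  ⟨hf.1.add hg.1, fun x y => by simp [fderiv_fun_add hf.1 hg.1, hf.2, hg.2]⟩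

theorem mul (hf : RotInvariantAt f Φ) (hg : RotInvariantAt g Φ) :
    RotInvariantAt (fun Ψ => f Ψ * g Ψ) Φ :=
  ⟨hf.1.mul hg.1, fun x y => by simp [fderiv_fun_mul hf.1 hg.1, hf.2, hg.2]⟩

theorem neg (hf : RotInvariantAt f Φ) : RotInvariantAt (fun Ψ => -f Ψ) Φ := by
  simpa using (const (-1)).mul hf

theorem sub (hf : RotInvariantAt f Φ) (hg : RotInvariantAt g Φ) :
    RotInvariantAt (fun Ψ => f Ψ - g Ψ) Φ := by
  simpa [sub_eq_add_neg] using hf.add hg.neg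

theorem div_const (hf : RotInvariantAt f Φ) (k : ℝ) : RotInvariantAt (fun Ψ => f Ψ / k) Φ := by
  simpa [div_eq_mul_inv] using hf.mul (const k⁻¹)

theorem sqrt (hf : RotInvariantAt f Φ) (h : 0 < f Φ) : RotInvariantAt (fun Ψ => √(f Ψ)) Φ :=
  ⟨hf.1.sqrt h.ne', fun x y => by simp [fderiv_sqrt hf.1 h.ne', hf.2]⟩

end RotInvariantAt

theorem fderiv_radial_swirl {s t μ : (Fin 6 → ℝ) → ℝ} {Φ : Fin 6 → ℝ}
    (hs : RotInvariantAt s Φ) (ht : RotInvariantAt t Φ) (hμ : RotInvariantAt μ Φ) (x y : ℝ) :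
    fderiv ℝ (radial s t μ) Φ (swirl Φ x y) = swirl Φ x (μ Φ * x) := by
  have h1 := hasFDerivAt_apply (𝕜 := ℝ) (1 : Fin 6) Φ
  have h2 := hasFDerivAt_apply (𝕜 := ℝ) (2 : Fin 6) Φ
  have h : HasFDerivAt (radial s t μ) (ContinuousLinearMap.pi
      ![fderiv ℝ s Φ, ContinuousLinearMap.proj 1, ContinuousLinearMap.proj 2, fderiv ℝ t Φ,
        μ Φ • ContinuousLinearMap.proj 1 + Φ 1 • fderiv ℝ μ Φ,
        μ Φ • ContinuousLinearMap.proj 2 + Φ 2 • fderiv ℝ μ Φ]) Φ := by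
    rw [hasFDerivAt_pi']
    intro i
    fin_cases i
    exacts [hs.1.hasFDerivAt, h1, h2, ht.1.hasFDerivAt, hμ.1.hasFDerivAt.mul h1,
      hμ.1.hasFDerivAt.mul h2]
  rw [h.fderiv]
  ext i
  fin_cases i <;> simp [hs.2, ht.2, hμ.2] <;> simp [swirl, mul_assoc]

theorem fderiv_swirl_radial {ν : (Fin 6 → ℝ) → ℝ} {Φ : Fin 6 → ℝ}
    (hν : DifferentiableAt ℝ ν Φ) (s t μ : (Fin 6 → ℝ) → ℝ) :
    fderiv ℝ (fun Ψ => swirl Ψ 1 (ν Ψ)) Φ (radial s t μ Φ) =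
      swirl Φ 1 (ν Φ + fderiv ℝ ν Φ (radial s t μ Φ)) := by
  have h1 := hasFDerivAt_apply (𝕜 := ℝ) (1 : Fin 6) Φ
  have h2 := hasFDerivAt_apply (𝕜 := ℝ) (2 : Fin 6) Φ
  have h : HasFDerivAt (fun Ψ => swirl Ψ 1 (ν Ψ)) (ContinuousLinearMap.pi
      ![0, (1 : ℝ) • ContinuousLinearMap.proj 2, -((1 : ℝ) • ContinuousLinearMap.proj 1), 0,
        ν Φ • ContinuousLinearMap.proj 2 + Φ 2 • fderiv ℝ ν Φ,
        -(ν Φ • ContinuousLinearMap.proj 1 + Φ 1 • fderiv ℝ ν Φ)]) Φ := by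
    rw [hasFDerivAt_pi']
    intro i
    fin_cases i
    exacts [hasFDerivAt_const _ _, h2.const_mul _, (h1.const_mul _).neg, hasFDerivAt_const _ _,
      hν.hasFDerivAt.mul h2, (hν.hasFDerivAt.mul h1).neg]
  rw [h.fderiv]
  ext i
  fin_cases i <;> simp [swirl] <;> simp [radial] <;> ring

/-- The region where `λ₁, λ₂, λ₃` are smooth. -/
def SmoothRegion (c₁ c₂ σ₀ σ₁ : ℝ) (Φ : Fin 6 → ℝ) : Prop :=
  0 < bb c₂ σ₁ Φ ∧ 0 < Del c₁ c₂ σ₀ σ₁ Φ ∧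
    0 < (aa c₁ σ₀ Φ + bb c₂ σ₁ Φ) / 2 - √(Del c₁ c₂ σ₀ σ₁ Φ) / 2

theorem exists_ball_smoothRegion (c₁ c₂ σ₀ σ₁ : ℝ) (hc : c₂ < c₁) (hc2 : 0 < c₂) :
    ∃ δ > (0 : ℝ), ∀ Φ : Fin 6 → ℝ, ‖Φ‖ < 2 * δ → SmoothRegion c₁ c₂ σ₀ σ₁ Φ := by
  have hopen : IsOpen {Φ | SmoothRegion c₁ c₂ σ₀ σ₁ Φ} := by
    simp only [SmoothRegion, Del, aa, bb, cc, dd, Set.ofPred_and]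
    refine .inter ?_ (.inter ?_ ?_) <;> exact isOpen_lt (by fun_prop) (by fun_prop)
  have hsq : 0 < c₁ ^ 2 - c₂ ^ 2 := by nlinarith
  have hzero : (0 : Fin 6 → ℝ) ∈ {Φ | SmoothRegion c₁ c₂ σ₀ σ₁ Φ} := by
    have hDel : Del c₁ c₂ σ₀ σ₁ 0 = (c₁ ^ 2 - c₂ ^ 2) ^ 2 := by simp [Del, aa, bb, cc, dd]
    refine ⟨by simp [bb]; positivity, by rw [hDel]; positivity, ?_⟩
    rw [hDel, Real.sqrt_sq hsq.le]
    simp only [aa, bb, Pi.zero_apply, mul_zero, add_zero]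
    nlinarith
  obtain ⟨ε, hε, hball⟩ := Metric.isOpen_iff.mp hopen 0 hzero
  exact ⟨ε / 2, by positivity, fun Φ hΦ => hball (by simpa using by linarith)⟩

section Coefficients

variable {c₁ c₂ σ₀ σ₁ : ℝ} {Φ : Fin 6 → ℝ}

theorem rotInvariantAt_bb : RotInvariantAt (bb c₂ σ₁) Φ :=
  (RotInvariantAt.const _).add ((RotInvariantAt.const _).mul .apply_zero)

theorem rotInvariantAt_lam2 (h : SmoothRegion c₁ c₂ σ₀ σ₁ Φ) :
    RotInvariantAt (lam2 c₁ c₂ σ₀ σ₁) Φ :=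
  rotInvariantAt_bb.sqrt h.1

theorem rotInvariantAt_lam3 (h : SmoothRegion c₁ c₂ σ₀ σ₁ Φ) :
    RotInvariantAt (lam3 c₁ c₂ σ₀ σ₁) Φ := by
  have ha : RotInvariantAt (aa c₁ σ₀) Φ :=
    (RotInvariantAt.const _).add ((RotInvariantAt.const _).mul .apply_zero)
  have hb : RotInvariantAt (bb c₂ σ₁) Φ := rotInvariantAt_bb
  have hD : RotInvariantAt (Del c₁ c₂ σ₀ σ₁) Φ := by
    convert ((ha.sub hb).mul (ha.sub hb)).add
      ((RotInvariantAt.const (16 * σ₁ ^ 2)).mul .sq_add_sq) using 2 with Ψ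
    simp only [Del, cc, dd]
    ring
  exact (((ha.add hb).div_const 2).sub ((hD.sqrt h.2.1).div_const 2)).sqrt h.2.2

theorem dotProduct_swirl_eq_zero {i : Fin 6} (hi : i ∉ ({1, 4} : Finset (Fin 6))) (x y : ℝ) :
    lvK c₁ c₂ σ₀ σ₁ i Φ ⬝ᵥ swirl Φ x y = 0 := by
  fin_cases i <;> first
    | exact absurd hi (by decide)
    | (simp [lvK, l1, l3, l4, l6, swirl, dotProduct, Fin.sum_univ_succ]; ring)

theorem rvK_one : rvK c₁ c₂ σ₀ σ₁ 1 = fun Ψ => swirl Ψ 1 (-lam2 c₁ c₂ σ₀ σ₁ Ψ) := by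
  ext Ψ i
  fin_cases i <;> simp [rvK, r2, swirl]

theorem rvK_four : rvK c₁ c₂ σ₀ σ₁ 4 = fun Ψ => swirl Ψ 1 (lam2 c₁ c₂ σ₀ σ₁ Ψ) := by
  ext Ψ i
  fin_cases i <;> simp [rvK, r5, swirl]

theorem exists_rvK_eq_swirl (h : SmoothRegion c₁ c₂ σ₀ σ₁ Φ) {m : Fin 6}
    (hm : m ∈ ({1, 4} : Finset (Fin 6))) :
    ∃ ν, DifferentiableAt ℝ ν Φ ∧ rvK c₁ c₂ σ₀ σ₁ m = fun Ψ => swirl Ψ 1 (ν Ψ) := by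
  have hlam := (rotInvariantAt_lam2 h).1
  simp only [Finset.mem_insert, Finset.mem_singleton] at hm
  rcases hm with rfl | rfl
  exacts [⟨_, hlam.neg, rvK_one⟩, ⟨_, hlam, rvK_four⟩]

theorem exists_rvK_eq_radial (h : SmoothRegion c₁ c₂ σ₀ σ₁ Φ) {k : Fin 6}
    (hk : k ∈ ({2, 3} : Finset (Fin 6))) :
    ∃ s t μ, RotInvariantAt s Φ ∧ RotInvariantAt t Φ ∧ RotInvariantAt μ Φ ∧
      rvK c₁ c₂ σ₀ σ₁ k = radial s t μ := by
  have hlam := rotInvariantAt_lam3 h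
  have hw : RotInvariantAt (fun Ψ => lam3 c₁ c₂ σ₀ σ₁ Ψ ^ 2 - bb c₂ σ₁ Ψ) Φ := by
    simpa only [sq] using (hlam.mul hlam).sub rotInvariantAt_bb
  simp only [Finset.mem_insert, Finset.mem_singleton] at hk
  rcases hk with rfl | rfl
  · exact ⟨_, _, _, hw.div_const (2 * σ₁), (hlam.mul hw).neg.div_const (2 * σ₁), hlam.neg, rfl⟩
  · exact ⟨_, _, _, hw.div_const (2 * σ₁), (hlam.mul hw).div_const (2 * σ₁), hlam, rfl⟩

theorem exists_fderiv_radial_eq_swirl (h : SmoothRegion c₁ c₂ σ₀ σ₁ Φ) {k m : Fin 6}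
    (hk : k ∈ ({2, 3} : Finset (Fin 6))) (hm : m ∈ ({1, 4} : Finset (Fin 6))) :
    ∃ x y, fderiv ℝ (rvK c₁ c₂ σ₀ σ₁ k) Φ (rvK c₁ c₂ σ₀ σ₁ m Φ) = swirl Φ x y := by
  obtain ⟨s, t, μ, hs, ht, hμ, hr⟩ := exists_rvK_eq_radial h hk
  obtain ⟨ν, -, hr'⟩ := exists_rvK_eq_swirl h hm
  exact ⟨_, _, by rw [hr, hr']; exact fderiv_radial_swirl hs ht hμ _ _⟩

theorem exists_fderiv_rotational_eq_swirl (h : SmoothRegion c₁ c₂ σ₀ σ₁ Φ) {k m : Fin 6}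
    (hk : k ∈ ({2, 3} : Finset (Fin 6))) (hm : m ∈ ({1, 4} : Finset (Fin 6))) :
    ∃ x y, fderiv ℝ (rvK c₁ c₂ σ₀ σ₁ m) Φ (rvK c₁ c₂ σ₀ σ₁ k Φ) = swirl Φ x y := by
  obtain ⟨s, t, μ, -, -, -, hr⟩ := exists_rvK_eq_radial h hk
  obtain ⟨ν, hν, hr'⟩ := exists_rvK_eq_swirl h hm
  exact ⟨_, _, by rw [hr, hr']; exact fderiv_swirl_radial hν s t μ⟩

theorem gamD_radial_rotational (h : SmoothRegion c₁ c₂ σ₀ σ₁ Φ) {i k m : Fin 6}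
    (hi : i ∉ ({1, 4} : Finset (Fin 6))) (hk : k ∈ ({2, 3} : Finset (Fin 6)))
    (hm : m ∈ ({1, 4} : Finset (Fin 6))) : gamD c₁ c₂ σ₀ σ₁ i k m Φ = 0 := by
  obtain ⟨x, y, hxy⟩ := exists_fderiv_radial_eq_swirl h hk hm
  rw [gamD, hxy, dotProduct_swirl_eq_zero hi, mul_zero]

theorem gamD_rotational_radial (h : SmoothRegion c₁ c₂ σ₀ σ₁ Φ) {i k m : Fin 6}
    (hi : i ∉ ({1, 4} : Finset (Fin 6))) (hk : k ∈ ({2, 3} : Finset (Fin 6)))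
    (hm : m ∈ ({1, 4} : Finset (Fin 6))) : gamD c₁ c₂ σ₀ σ₁ i m k Φ = 0 := by
  obtain ⟨x, y, hxy⟩ := exists_fderiv_rotational_eq_swirl h hk hm
  rw [gamD, hxy, dotProduct_swirl_eq_zero hi, mul_zero]

theorem gamS_radial_rotational (h : SmoothRegion c₁ c₂ σ₀ σ₁ Φ) {k m : Fin 6}
    (hi : k ∉ ({1, 4} : Finset (Fin 6))) (hk : k ∈ ({2, 3} : Finset (Fin 6)))
    (hm : m ∈ ({1, 4} : Finset (Fin 6))) : gamS c₁ c₂ σ₀ σ₁ k m Φ = 0 := by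
  obtain ⟨x, y, hxy⟩ := exists_fderiv_radial_eq_swirl h hk hm
  obtain ⟨x', y', hxy'⟩ := exists_fderiv_rotational_eq_swirl h hk hm
  rw [gamS, hxy, hxy', swirl_sub, dotProduct_swirl_eq_zero hi, mul_zero]

theorem cC_radial_rotational (h : SmoothRegion c₁ c₂ σ₀ σ₁ Φ) {k m : Fin 6}
    (hk : k ∈ ({2, 3} : Finset (Fin 6))) (hm : m ∈ ({1, 4} : Finset (Fin 6))) :
    cC c₁ c₂ σ₀ σ₁ k m Φ = 0 := by
  obtain ⟨ν, -, hr⟩ := exists_rvK_eq_swirl h hm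
  have hlam : RotInvariantAt (lamv c₁ c₂ σ₀ σ₁ k) Φ := by
    simp only [Finset.mem_insert, Finset.mem_singleton] at hk
    rcases hk with rfl | rfl
    exacts [rotInvariantAt_lam3 h, (rotInvariantAt_lam3 h).neg]
  rw [cC, hr]
  exact hlam.2 _ _

end Coefficients

/-- **Vanishing interaction coefficients** (Proposition 3.2, first part).
Indices are 0-based: the paper's `γ_{km}^i` is `gamD (i−1) (k−1) (m−1)`,
`γ_{im}^i` is `gamS (i−1) (m−1)`, and `c_{im}^i` is `cC (i−1) (m−1)`. -/
theorem vanishing_interaction_coefficients (c₁ c₂ σ₀ σ₁ : ℝ)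
    (hc : c₂ < c₁) (hc2 : 0 < c₂) (hσ0 : σ₀ ≠ 0) (hσ1 : σ₁ ≠ 0) :
    ∃ δ > (0 : ℝ), ∀ Φ : Fin 6 → ℝ, ‖Φ‖ < 2 * δ → ¬(Φ 1 = 0 ∧ Φ 2 = 0) →
      -- i = 1 : γ₂₃¹ = 0, γ₃₂¹ = 0, γ₄₅¹ + γ₅₄¹ = 0
      (gamD c₁ c₂ σ₀ σ₁ 0 1 2 Φ = 0 ∧ gamD c₁ c₂ σ₀ σ₁ 0 2 1 Φ = 0 ∧
        gamD c₁ c₂ σ₀ σ₁ 0 3 4 Φ + gamD c₁ c₂ σ₀ σ₁ 0 4 3 Φ = 0) ∧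
      -- i = 3 : c₃₂³ = 0, γ₃₂³ = 0, γ₄₅³ = γ₅₄³ = 0
      (cC c₁ c₂ σ₀ σ₁ 2 1 Φ = 0 ∧ gamS c₁ c₂ σ₀ σ₁ 2 1 Φ = 0 ∧
        gamD c₁ c₂ σ₀ σ₁ 2 3 4 Φ = 0 ∧ gamD c₁ c₂ σ₀ σ₁ 2 4 3 Φ = 0) ∧
      -- i = 4 : c₄₅⁴ = 0, γ₄₅⁴ = 0, γ₂₃⁴ = γ₃₂⁴ = 0
      (cC c₁ c₂ σ₀ σ₁ 3 4 Φ = 0 ∧ gamS c₁ c₂ σ₀ σ₁ 3 4 Φ = 0 ∧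
        gamD c₁ c₂ σ₀ σ₁ 3 1 2 Φ = 0 ∧ gamD c₁ c₂ σ₀ σ₁ 3 2 1 Φ = 0) ∧
      -- i = 6 : γ₂₃⁶ = γ₃₂⁶ = 0, γ₄₅⁶ = γ₅₄⁶ = 0
      (gamD c₁ c₂ σ₀ σ₁ 5 1 2 Φ = 0 ∧ gamD c₁ c₂ σ₀ σ₁ 5 2 1 Φ = 0 ∧
        gamD c₁ c₂ σ₀ σ₁ 5 3 4 Φ = 0 ∧ gamD c₁ c₂ σ₀ σ₁ 5 4 3 Φ = 0) := by
  obtain ⟨δ, hδ, hsmooth⟩ := exists_ball_smoothRegion c₁ c₂ σ₀ σ₁ hc hc2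
  refine ⟨δ, hδ, fun Φ hΦ _ => ?_⟩
  have h := hsmooth Φ hΦ
  have hRT {i k m : Fin 6} := gamD_radial_rotational h (i := i) (k := k) (m := m)
  have hTR {i k m : Fin 6} := gamD_rotational_radial h (i := i) (k := k) (m := m)
  have hS {k m : Fin 6} := gamS_radial_rotational h (k := k) (m := m)
  have hC {k m : Fin 6} := cC_radial_rotational h (k := k) (m := m)
  refine ⟨⟨?_, ?_, ?_⟩, ⟨?_, ?_, ?_, ?_⟩, ⟨?_, ?_, ?_, ?_⟩, ?_, ?_, ?_, ?_⟩
  case refine_3 => rw [hRT (by decide) (by decide) (by decide),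
    hTR (by decide) (by decide) (by decide), add_zero]
  all_goals first
    | exact hRT (by decide) (by decide) (by decide)
    | exact hTR (by decide) (by decide) (by decide)
    | exact hS (by decide) (by decide) (by decide)
    | exact hC (by decide) (by decide)
end
end

section
/- 2D strict hyperbolicity and genuine nonlinearity (Lemma 11.1): For every Φ ∈ ℝ⁴ and λ ∈ ℝ, det(λ·I₄ − A(Φ)) = (λ²−a)(λ²−b) − c². Moreover there exists δ > 0 such that for every Φ ∈ ℝ⁴ with |Φ| < 2δ: the radicands defining λ₁,…,λ₄ are positive, the four numbers satisfy λ₄ < λ₃ < λ₂ < λ₁ (uniform strict hyperbolicity), A(Φ)·r_i = λ_i·r_i for i = 1,…,4, and ∇λ₁(Φ)·r₁(Φ) = −∇λ₄(Φ)·r₄(Φ) = (2σ₀(a−b)(λ₁²−b) + (2σ₀+6σ₁)c²)/(4σ₁λ₁√Δ), which is nonzero (genuine nonlinearity of the 1st and 4th characteristic fields). -/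
set_option linter.unusedVariables false

noncomputable section

open Real Matrix

/-- `a = c₁² + 2σ₀φ₁`. -/
def aa4 (c₁ σ₀ : ℝ) (Φ : Fin 4 → ℝ) : ℝ := c₁ ^ 2 + 2 * σ₀ * Φ 0
/-- `b = c₂² + 2σ₁φ₁`. -/
def bb4 (c₂ σ₁ : ℝ) (Φ : Fin 4 → ℝ) : ℝ := c₂ ^ 2 + 2 * σ₁ * Φ 0
/-- `c = 2σ₁φ₂`. -/
def cc4 (σ₁ : ℝ) (Φ : Fin 4 → ℝ) : ℝ := 2 * σ₁ * Φ 1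

/-- The coefficient matrix `A(Φ)` of the 4×4 first-order system (2D elastic plane waves). -/
def Amat4 (c₁ c₂ σ₀ σ₁ : ℝ) (Φ : Fin 4 → ℝ) : Matrix (Fin 4) (Fin 4) ℝ :=
  Matrix.of
    ![![0, 0, -1, 0],
      ![0, 0, 0, -1],
      ![-aa4 c₁ σ₀ Φ, -cc4 σ₁ Φ, 0, 0],
      ![-cc4 σ₁ Φ, -bb4 c₂ σ₁ Φ, 0, 0]]

/-- `Δ = (a−b)² + 4c²`. -/
def Del4 (c₁ c₂ σ₀ σ₁ : ℝ) (Φ : Fin 4 → ℝ) : ℝ :=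
  (aa4 c₁ σ₀ Φ - bb4 c₂ σ₁ Φ) ^ 2 + 4 * (cc4 σ₁ Φ) ^ 2

/-- `λ₁ = ((a+b)/2 + √Δ/2)^{1/2}`. -/
def mu1 (c₁ c₂ σ₀ σ₁ : ℝ) (Φ : Fin 4 → ℝ) : ℝ :=
  Real.sqrt ((aa4 c₁ σ₀ Φ + bb4 c₂ σ₁ Φ) / 2 + Real.sqrt (Del4 c₁ c₂ σ₀ σ₁ Φ) / 2)
/-- `λ₂ = ((a+b)/2 − √Δ/2)^{1/2}`. -/
def mu2 (c₁ c₂ σ₀ σ₁ : ℝ) (Φ : Fin 4 → ℝ) : ℝ :=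
  Real.sqrt ((aa4 c₁ σ₀ Φ + bb4 c₂ σ₁ Φ) / 2 - Real.sqrt (Del4 c₁ c₂ σ₀ σ₁ Φ) / 2)
/-- `λ₃ = −λ₂`. -/
def mu3 (c₁ c₂ σ₀ σ₁ : ℝ) (Φ : Fin 4 → ℝ) : ℝ := -mu2 c₁ c₂ σ₀ σ₁ Φ
/-- `λ₄ = −λ₁`. -/
def mu4 (c₁ c₂ σ₀ σ₁ : ℝ) (Φ : Fin 4 → ℝ) : ℝ := -mu1 c₁ c₂ σ₀ σ₁ Φ

/-- Right eigenvector `r₁`. -/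
def s1 (c₁ c₂ σ₀ σ₁ : ℝ) (Φ : Fin 4 → ℝ) : Fin 4 → ℝ :=
  ![((mu1 c₁ c₂ σ₀ σ₁ Φ) ^ 2 - bb4 c₂ σ₁ Φ) / (2 * σ₁), Φ 1,
    -(mu1 c₁ c₂ σ₀ σ₁ Φ * ((mu1 c₁ c₂ σ₀ σ₁ Φ) ^ 2 - bb4 c₂ σ₁ Φ)) / (2 * σ₁),
    -(mu1 c₁ c₂ σ₀ σ₁ Φ) * Φ 1]

/-- Right eigenvector `r₂`. -/
def s2 (c₁ c₂ σ₀ σ₁ : ℝ) (Φ : Fin 4 → ℝ) : Fin 4 → ℝ :=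
  ![((mu2 c₁ c₂ σ₀ σ₁ Φ) ^ 2 - bb4 c₂ σ₁ Φ) / (2 * σ₁), Φ 1,
    -(mu2 c₁ c₂ σ₀ σ₁ Φ * ((mu2 c₁ c₂ σ₀ σ₁ Φ) ^ 2 - bb4 c₂ σ₁ Φ)) / (2 * σ₁),
    -(mu2 c₁ c₂ σ₀ σ₁ Φ) * Φ 1]

/-- Right eigenvector `r₃`. -/
def s3 (c₁ c₂ σ₀ σ₁ : ℝ) (Φ : Fin 4 → ℝ) : Fin 4 → ℝ :=
  ![((mu2 c₁ c₂ σ₀ σ₁ Φ) ^ 2 - bb4 c₂ σ₁ Φ) / (2 * σ₁), Φ 1,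
    mu2 c₁ c₂ σ₀ σ₁ Φ * ((mu2 c₁ c₂ σ₀ σ₁ Φ) ^ 2 - bb4 c₂ σ₁ Φ) / (2 * σ₁),
    mu2 c₁ c₂ σ₀ σ₁ Φ * Φ 1]

/-- Right eigenvector `r₄`. -/
def s4 (c₁ c₂ σ₀ σ₁ : ℝ) (Φ : Fin 4 → ℝ) : Fin 4 → ℝ :=
  ![((mu1 c₁ c₂ σ₀ σ₁ Φ) ^ 2 - bb4 c₂ σ₁ Φ) / (2 * σ₁), Φ 1,
    mu1 c₁ c₂ σ₀ σ₁ Φ * ((mu1 c₁ c₂ σ₀ σ₁ Φ) ^ 2 - bb4 c₂ σ₁ Φ) / (2 * σ₁),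
    mu1 c₁ c₂ σ₀ σ₁ Φ * Φ 1]

/-- `K = (Δ + (a−b)√Δ)/(4σ₁²)`. -/
def Kc4 (c₁ c₂ σ₀ σ₁ : ℝ) (Φ : Fin 4 → ℝ) : ℝ :=
  (Del4 c₁ c₂ σ₀ σ₁ Φ + (aa4 c₁ σ₀ Φ - bb4 c₂ σ₁ Φ) * Real.sqrt (Del4 c₁ c₂ σ₀ σ₁ Φ)) /
    (4 * σ₁ ^ 2)

/-- `N = (Δ − (a−b)√Δ)/(4σ₁²)`. -/
def Nc4 (c₁ c₂ σ₀ σ₁ : ℝ) (Φ : Fin 4 → ℝ) : ℝ :=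
  (Del4 c₁ c₂ σ₀ σ₁ Φ - (aa4 c₁ σ₀ Φ - bb4 c₂ σ₁ Φ) * Real.sqrt (Del4 c₁ c₂ σ₀ σ₁ Φ)) /
    (4 * σ₁ ^ 2)

/-- Left eigenvector `l¹`. -/
def t1 (c₁ c₂ σ₀ σ₁ : ℝ) (Φ : Fin 4 → ℝ) : Fin 4 → ℝ :=
  (1 / Kc4 c₁ c₂ σ₀ σ₁ Φ) •
    ![((mu1 c₁ c₂ σ₀ σ₁ Φ) ^ 2 - bb4 c₂ σ₁ Φ) / (2 * σ₁), Φ 1,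
      -(((mu1 c₁ c₂ σ₀ σ₁ Φ) ^ 2 - bb4 c₂ σ₁ Φ) / (2 * σ₁ * mu1 c₁ c₂ σ₀ σ₁ Φ)),
      -(Φ 1 / mu1 c₁ c₂ σ₀ σ₁ Φ)]

/-- Left eigenvector `l²`. -/
def t2 (c₁ c₂ σ₀ σ₁ : ℝ) (Φ : Fin 4 → ℝ) : Fin 4 → ℝ :=
  (1 / Nc4 c₁ c₂ σ₀ σ₁ Φ) •
    ![((mu2 c₁ c₂ σ₀ σ₁ Φ) ^ 2 - bb4 c₂ σ₁ Φ) / (2 * σ₁), Φ 1,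
      -(((mu2 c₁ c₂ σ₀ σ₁ Φ) ^ 2 - bb4 c₂ σ₁ Φ) / (2 * σ₁ * mu2 c₁ c₂ σ₀ σ₁ Φ)),
      -(Φ 1 / mu2 c₁ c₂ σ₀ σ₁ Φ)]

/-- Left eigenvector `l³`. -/
def t3 (c₁ c₂ σ₀ σ₁ : ℝ) (Φ : Fin 4 → ℝ) : Fin 4 → ℝ :=
  (1 / Nc4 c₁ c₂ σ₀ σ₁ Φ) •
    ![((mu2 c₁ c₂ σ₀ σ₁ Φ) ^ 2 - bb4 c₂ σ₁ Φ) / (2 * σ₁), Φ 1,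
      ((mu2 c₁ c₂ σ₀ σ₁ Φ) ^ 2 - bb4 c₂ σ₁ Φ) / (2 * σ₁ * mu2 c₁ c₂ σ₀ σ₁ Φ),
      Φ 1 / mu2 c₁ c₂ σ₀ σ₁ Φ]

/-- Left eigenvector `l⁴`. -/
def t4 (c₁ c₂ σ₀ σ₁ : ℝ) (Φ : Fin 4 → ℝ) : Fin 4 → ℝ :=
  (1 / Kc4 c₁ c₂ σ₀ σ₁ Φ) •
    ![((mu1 c₁ c₂ σ₀ σ₁ Φ) ^ 2 - bb4 c₂ σ₁ Φ) / (2 * σ₁), Φ 1,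
      ((mu1 c₁ c₂ σ₀ σ₁ Φ) ^ 2 - bb4 c₂ σ₁ Φ) / (2 * σ₁ * mu1 c₁ c₂ σ₀ σ₁ Φ),
      Φ 1 / mu1 c₁ c₂ σ₀ σ₁ Φ]

/-- The family `i ↦ r_i` (0-indexed). -/
def svK (c₁ c₂ σ₀ σ₁ : ℝ) (i : Fin 4) (Φ : Fin 4 → ℝ) : Fin 4 → ℝ :=
  ![s1 c₁ c₂ σ₀ σ₁ Φ, s2 c₁ c₂ σ₀ σ₁ Φ, s3 c₁ c₂ σ₀ σ₁ Φ, s4 c₁ c₂ σ₀ σ₁ Φ] i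

/-- The family `i ↦ l^i` (0-indexed). -/
def tvK (c₁ c₂ σ₀ σ₁ : ℝ) (i : Fin 4) (Φ : Fin 4 → ℝ) : Fin 4 → ℝ :=
  ![t1 c₁ c₂ σ₀ σ₁ Φ, t2 c₁ c₂ σ₀ σ₁ Φ, t3 c₁ c₂ σ₀ σ₁ Φ, t4 c₁ c₂ σ₀ σ₁ Φ] i

theorem continuous_aa4 (c₁ σ₀ : ℝ) : Continuous (aa4 c₁ σ₀) := by
  unfold aa4; fun_prop

theorem continuous_bb4 (c₂ σ₁ : ℝ) : Continuous (bb4 c₂ σ₁) := by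
  unfold bb4; fun_prop

theorem continuous_cc4 (σ₁ : ℝ) : Continuous (cc4 σ₁) := by
  unfold cc4; fun_prop

theorem continuous_Del4 (c₁ c₂ σ₀ σ₁ : ℝ) : Continuous (Del4 c₁ c₂ σ₀ σ₁) := by
  have ha := continuous_aa4 c₁ σ₀
  have hb := continuous_bb4 c₂ σ₁
  have hc := continuous_cc4 σ₁
  unfold Del4; fun_prop

theorem det_smul_one_sub_Amat4 (c₁ c₂ σ₀ σ₁ : ℝ) (Φ : Fin 4 → ℝ) (lam : ℝ) :
    (lam • (1 : Matrix (Fin 4) (Fin 4) ℝ) - Amat4 c₁ c₂ σ₀ σ₁ Φ).det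
      = (lam ^ 2 - aa4 c₁ σ₀ Φ) * (lam ^ 2 - bb4 c₂ σ₁ Φ) - (cc4 σ₁ Φ) ^ 2 := by
  simp [Matrix.det_succ_row_zero, Fin.sum_univ_succ, Amat4, Matrix.one_apply, Fin.succAbove]
  ring

/-- A root `m` of the characteristic polynomial of `A(Φ)` has eigenvector
`((m² − b)/(2σ₁), φ₂, −m(m² − b)/(2σ₁), −mφ₂)`. -/
theorem Amat4_mulVec_eq_smul {c₁ c₂ σ₀ σ₁ : ℝ} (hσ1 : σ₁ ≠ 0) {Φ : Fin 4 → ℝ} {m : ℝ}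
    (hm : (m ^ 2 - aa4 c₁ σ₀ Φ) * (m ^ 2 - bb4 c₂ σ₁ Φ) = (cc4 σ₁ Φ) ^ 2) :
    Amat4 c₁ c₂ σ₀ σ₁ Φ *ᵥ
        ![(m ^ 2 - bb4 c₂ σ₁ Φ) / (2 * σ₁), Φ 1, -(m * (m ^ 2 - bb4 c₂ σ₁ Φ)) / (2 * σ₁), -m * Φ 1]
      = m • ![(m ^ 2 - bb4 c₂ σ₁ Φ) / (2 * σ₁), Φ 1, -(m * (m ^ 2 - bb4 c₂ σ₁ Φ)) / (2 * σ₁),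
          -m * Φ 1] := by
  ext i
  fin_cases i <;> simp [Amat4, Matrix.mulVec, dotProduct, Fin.sum_univ_succ]
  · ring
  · field_simp
    have hcΦ : cc4 σ₁ Φ = 2 * σ₁ * Φ 1 := rfl
    linear_combination hm + cc4 σ₁ Φ * hcΦ
  · have hcΦ : cc4 σ₁ Φ = 2 * σ₁ * Φ 1 := rfl
    rw [hcΦ]
    field_simp
    ring

theorem mu1_sq {c₁ c₂ σ₀ σ₁ : ℝ} {Φ : Fin 4 → ℝ}
    (h : 0 ≤ (aa4 c₁ σ₀ Φ + bb4 c₂ σ₁ Φ) / 2 + Real.sqrt (Del4 c₁ c₂ σ₀ σ₁ Φ) / 2) :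
    mu1 c₁ c₂ σ₀ σ₁ Φ ^ 2 =
      (aa4 c₁ σ₀ Φ + bb4 c₂ σ₁ Φ) / 2 + Real.sqrt (Del4 c₁ c₂ σ₀ σ₁ Φ) / 2 :=
  Real.sq_sqrt h

theorem mu2_sq {c₁ c₂ σ₀ σ₁ : ℝ} {Φ : Fin 4 → ℝ}
    (h : 0 ≤ (aa4 c₁ σ₀ Φ + bb4 c₂ σ₁ Φ) / 2 - Real.sqrt (Del4 c₁ c₂ σ₀ σ₁ Φ) / 2) :
    mu2 c₁ c₂ σ₀ σ₁ Φ ^ 2 =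
      (aa4 c₁ σ₀ Φ + bb4 c₂ σ₁ Φ) / 2 - Real.sqrt (Del4 c₁ c₂ σ₀ σ₁ Φ) / 2 :=
  Real.sq_sqrt h

theorem sq_sqrt_Del4 (c₁ c₂ σ₀ σ₁ : ℝ) (Φ : Fin 4 → ℝ) :
    Real.sqrt (Del4 c₁ c₂ σ₀ σ₁ Φ) ^ 2 =
      (aa4 c₁ σ₀ Φ - bb4 c₂ σ₁ Φ) ^ 2 + 4 * (cc4 σ₁ Φ) ^ 2 :=
  Real.sq_sqrt (by unfold Del4; positivity)

theorem fderiv_mu1_apply {c₁ c₂ σ₀ σ₁ : ℝ} {Φ : Fin 4 → ℝ} (hΔ : 0 < Del4 c₁ c₂ σ₀ σ₁ Φ)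
    (h : 0 < (aa4 c₁ σ₀ Φ + bb4 c₂ σ₁ Φ) / 2 + Real.sqrt (Del4 c₁ c₂ σ₀ σ₁ Φ) / 2)
    (v : Fin 4 → ℝ) :
    fderiv ℝ (mu1 c₁ c₂ σ₀ σ₁) Φ v =
      ((σ₀ + σ₁) * v 0 +
        ((aa4 c₁ σ₀ Φ - bb4 c₂ σ₁ Φ) * (σ₀ - σ₁) * v 0 + 4 * cc4 σ₁ Φ * σ₁ * v 1) /
          Real.sqrt (Del4 c₁ c₂ σ₀ σ₁ Φ)) / (2 * mu1 c₁ c₂ σ₀ σ₁ Φ) := by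
  have hcoord (i : Fin 4) : HasFDerivAt (fun Ψ : Fin 4 → ℝ ↦ Ψ i)
      (ContinuousLinearMap.proj i : (Fin 4 → ℝ) →L[ℝ] ℝ) Φ := hasFDerivAt_apply i Φ
  have ha : HasFDerivAt (aa4 c₁ σ₀) _ Φ := ((hcoord 0).const_mul (2 * σ₀)).const_add (c₁ ^ 2)
  have hb : HasFDerivAt (bb4 c₂ σ₁) _ Φ := ((hcoord 0).const_mul (2 * σ₁)).const_add (c₂ ^ 2)
  have hc : HasFDerivAt (cc4 σ₁) _ Φ := (hcoord 1).const_mul (2 * σ₁)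
  have hD : HasFDerivAt (Del4 c₁ c₂ σ₀ σ₁) _ Φ :=
    ((ha.fun_sub hb).pow 2).fun_add ((hc.pow 2).const_mul 4)
  have hmu : HasFDerivAt (mu1 c₁ c₂ σ₀ σ₁) _ Φ :=
    (((ha.fun_add hb).mul_const (2⁻¹)).fun_add ((hD.sqrt hΔ.ne').mul_const (2⁻¹))).sqrt
      (by simpa only [div_eq_mul_inv] using h.ne')
  have hS : 0 < Real.sqrt (Del4 c₁ c₂ σ₀ σ₁ Φ) := Real.sqrt_pos.mpr hΔ
  have hm : 0 < mu1 c₁ c₂ σ₀ σ₁ Φ := Real.sqrt_pos.mpr h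
  have hmdef : Real.sqrt ((aa4 c₁ σ₀ Φ + bb4 c₂ σ₁ Φ) * 2⁻¹ +
      Real.sqrt (Del4 c₁ c₂ σ₀ σ₁ Φ) * 2⁻¹) = mu1 c₁ c₂ σ₀ σ₁ Φ := by
    simp only [mu1, div_eq_mul_inv]
  rw [hmu.fderiv, hmdef]
  simp
  field_simp

theorem fderiv_mu4 (c₁ c₂ σ₀ σ₁ : ℝ) (Φ : Fin 4 → ℝ) :
    fderiv ℝ (mu4 c₁ c₂ σ₀ σ₁) Φ = -fderiv ℝ (mu1 c₁ c₂ σ₀ σ₁) Φ :=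
  fderiv_fun_neg

theorem fderiv_mu1_s1 {c₁ c₂ σ₀ σ₁ : ℝ} (hσ1 : σ₁ ≠ 0) {Φ : Fin 4 → ℝ}
    (hΔ : 0 < Del4 c₁ c₂ σ₀ σ₁ Φ)
    (h : 0 < (aa4 c₁ σ₀ Φ + bb4 c₂ σ₁ Φ) / 2 + Real.sqrt (Del4 c₁ c₂ σ₀ σ₁ Φ) / 2) :
    fderiv ℝ (mu1 c₁ c₂ σ₀ σ₁) Φ (s1 c₁ c₂ σ₀ σ₁ Φ) =
      (2 * σ₀ * (aa4 c₁ σ₀ Φ - bb4 c₂ σ₁ Φ) * ((mu1 c₁ c₂ σ₀ σ₁ Φ) ^ 2 - bb4 c₂ σ₁ Φ)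
        + (2 * σ₀ + 6 * σ₁) * (cc4 σ₁ Φ) ^ 2) /
      (4 * σ₁ * mu1 c₁ c₂ σ₀ σ₁ Φ * Real.sqrt (Del4 c₁ c₂ σ₀ σ₁ Φ)) := by
  have hS : 0 < Real.sqrt (Del4 c₁ c₂ σ₀ σ₁ Φ) := Real.sqrt_pos.mpr hΔ
  have hm : 0 < mu1 c₁ c₂ σ₀ σ₁ Φ := Real.sqrt_pos.mpr h
  have hS2 := sq_sqrt_Del4 c₁ c₂ σ₀ σ₁ Φ
  have hm2 := mu1_sq h.le
  have e0 : s1 c₁ c₂ σ₀ σ₁ Φ 0 = ((mu1 c₁ c₂ σ₀ σ₁ Φ) ^ 2 - bb4 c₂ σ₁ Φ) / (2 * σ₁) := rfl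
  have e1 : s1 c₁ c₂ σ₀ σ₁ Φ 1 = cc4 σ₁ Φ / (2 * σ₁) := by
    simp only [s1, cc4, Matrix.cons_val_one, Matrix.cons_val_zero]; field_simp
  rw [fderiv_mu1_apply hΔ h, e0, e1, hm2]
  field_simp
  linear_combination 4 * (σ₀ + σ₁) * hS2

/-- Positivity of the radicands and nonvanishing of the genuine nonlinearity coefficient hold
near the origin. -/
theorem eventually_strict_hyperbolicity (c₁ c₂ σ₀ σ₁ : ℝ) (hc : c₂ < c₁) (hc2 : 0 < c₂)
    (hσ0 : σ₀ ≠ 0) :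
    ∀ᶠ Φ : Fin 4 → ℝ in nhds 0, 0 < Del4 c₁ c₂ σ₀ σ₁ Φ ∧
      0 < (aa4 c₁ σ₀ Φ + bb4 c₂ σ₁ Φ) / 2 - Real.sqrt (Del4 c₁ c₂ σ₀ σ₁ Φ) / 2 ∧
      2 * σ₀ * (aa4 c₁ σ₀ Φ - bb4 c₂ σ₁ Φ) *
          ((aa4 c₁ σ₀ Φ + bb4 c₂ σ₁ Φ) / 2 + Real.sqrt (Del4 c₁ c₂ σ₀ σ₁ Φ) / 2 - bb4 c₂ σ₁ Φ)
        + (2 * σ₀ + 6 * σ₁) * (cc4 σ₁ Φ) ^ 2 ≠ 0 := by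
  have ha := continuous_aa4 c₁ σ₀
  have hb := continuous_bb4 c₂ σ₁
  have hcc := continuous_cc4 σ₁
  have hD := continuous_Del4 c₁ c₂ σ₀ σ₁
  have hgap : 0 < c₁ ^ 2 - c₂ ^ 2 := by nlinarith
  have a0 : aa4 c₁ σ₀ 0 = c₁ ^ 2 := by simp [aa4]
  have b0 : bb4 c₂ σ₁ 0 = c₂ ^ 2 := by simp [bb4]
  have cc0 : cc4 σ₁ 0 = 0 := by simp [cc4]
  have D0 : Del4 c₁ c₂ σ₀ σ₁ 0 = (c₁ ^ 2 - c₂ ^ 2) ^ 2 := by simp [Del4, a0, b0, cc0]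
  have S0 : Real.sqrt (Del4 c₁ c₂ σ₀ σ₁ 0) = c₁ ^ 2 - c₂ ^ 2 := by
    rw [D0, Real.sqrt_sq hgap.le]
  refine (continuousAt_const.eventually_lt hD.continuousAt ?_).and
    ((continuousAt_const.eventually_lt (by fun_prop) ?_).and
      (ContinuousAt.eventually_ne (by fun_prop) ?_))
  · rw [D0]; positivity
  · rw [a0, b0, S0]
    nlinarith [sq_pos_of_pos hc2]
  · rw [a0, b0, cc0, S0]
    have : 2 * σ₀ * (c₁ ^ 2 - c₂ ^ 2) * ((c₁ ^ 2 + c₂ ^ 2) / 2 + (c₁ ^ 2 - c₂ ^ 2) / 2 - c₂ ^ 2)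
        + (2 * σ₀ + 6 * σ₁) * 0 ^ 2 = 2 * σ₀ * (c₁ ^ 2 - c₂ ^ 2) ^ 2 := by ring
    rw [this]
    positivity

/-- **2D strict hyperbolicity and genuine nonlinearity** (Lemma 11.1). -/
theorem strict_hyperbolicity_2D (c₁ c₂ σ₀ σ₁ : ℝ)
    (hc : c₂ < c₁) (hc2 : 0 < c₂) (hσ0 : σ₀ ≠ 0) (hσ1 : σ₁ ≠ 0) :
    (∀ (Φ : Fin 4 → ℝ) (lam : ℝ),
      (lam • (1 : Matrix (Fin 4) (Fin 4) ℝ) - Amat4 c₁ c₂ σ₀ σ₁ Φ).det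
        = (lam ^ 2 - aa4 c₁ σ₀ Φ) * (lam ^ 2 - bb4 c₂ σ₁ Φ) - (cc4 σ₁ Φ) ^ 2) ∧
    ∃ δ > (0 : ℝ), ∀ Φ : Fin 4 → ℝ, ‖Φ‖ < 2 * δ →
      -- the radicands defining `λ₁,…,λ₄` are positive
      (0 < Del4 c₁ c₂ σ₀ σ₁ Φ ∧
        0 < (aa4 c₁ σ₀ Φ + bb4 c₂ σ₁ Φ) / 2 - Real.sqrt (Del4 c₁ c₂ σ₀ σ₁ Φ) / 2 ∧
        0 < (aa4 c₁ σ₀ Φ + bb4 c₂ σ₁ Φ) / 2 + Real.sqrt (Del4 c₁ c₂ σ₀ σ₁ Φ) / 2) ∧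
      -- uniform strict hyperbolicity
      (mu4 c₁ c₂ σ₀ σ₁ Φ < mu3 c₁ c₂ σ₀ σ₁ Φ ∧ mu3 c₁ c₂ σ₀ σ₁ Φ < mu2 c₁ c₂ σ₀ σ₁ Φ ∧
        mu2 c₁ c₂ σ₀ σ₁ Φ < mu1 c₁ c₂ σ₀ σ₁ Φ) ∧
      -- eigenvector equations
      (Amat4 c₁ c₂ σ₀ σ₁ Φ *ᵥ s1 c₁ c₂ σ₀ σ₁ Φ = mu1 c₁ c₂ σ₀ σ₁ Φ • s1 c₁ c₂ σ₀ σ₁ Φ ∧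
        Amat4 c₁ c₂ σ₀ σ₁ Φ *ᵥ s2 c₁ c₂ σ₀ σ₁ Φ = mu2 c₁ c₂ σ₀ σ₁ Φ • s2 c₁ c₂ σ₀ σ₁ Φ ∧
        Amat4 c₁ c₂ σ₀ σ₁ Φ *ᵥ s3 c₁ c₂ σ₀ σ₁ Φ = mu3 c₁ c₂ σ₀ σ₁ Φ • s3 c₁ c₂ σ₀ σ₁ Φ ∧
        Amat4 c₁ c₂ σ₀ σ₁ Φ *ᵥ s4 c₁ c₂ σ₀ σ₁ Φ = mu4 c₁ c₂ σ₀ σ₁ Φ • s4 c₁ c₂ σ₀ σ₁ Φ) ∧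
      -- genuine nonlinearity of the 1st and 4th characteristic fields
      (fderiv ℝ (mu1 c₁ c₂ σ₀ σ₁) Φ (s1 c₁ c₂ σ₀ σ₁ Φ) =
          -(fderiv ℝ (mu4 c₁ c₂ σ₀ σ₁) Φ (s4 c₁ c₂ σ₀ σ₁ Φ)) ∧
        fderiv ℝ (mu1 c₁ c₂ σ₀ σ₁) Φ (s1 c₁ c₂ σ₀ σ₁ Φ) =
          (2 * σ₀ * (aa4 c₁ σ₀ Φ - bb4 c₂ σ₁ Φ) * ((mu1 c₁ c₂ σ₀ σ₁ Φ) ^ 2 - bb4 c₂ σ₁ Φ)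
            + (2 * σ₀ + 6 * σ₁) * (cc4 σ₁ Φ) ^ 2) /
          (4 * σ₁ * mu1 c₁ c₂ σ₀ σ₁ Φ * Real.sqrt (Del4 c₁ c₂ σ₀ σ₁ Φ)) ∧
        fderiv ℝ (mu1 c₁ c₂ σ₀ σ₁) Φ (s1 c₁ c₂ σ₀ σ₁ Φ) ≠ 0) := by
  refine ⟨det_smul_one_sub_Amat4 c₁ c₂ σ₀ σ₁, ?_⟩
  obtain ⟨ε, hε, hball⟩ :=
    Metric.eventually_nhds_iff.mp (eventually_strict_hyperbolicity c₁ c₂ σ₀ σ₁ hc hc2 hσ0)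
  refine ⟨ε / 2, half_pos hε, fun Φ hΦ ↦ ?_⟩
  obtain ⟨hΔ, hrad2, hnum⟩ := hball (y := Φ) (by rw [dist_zero_right]; linarith)
  have hS : 0 < Real.sqrt (Del4 c₁ c₂ σ₀ σ₁ Φ) := Real.sqrt_pos.mpr hΔ
  have hrad1 : 0 < (aa4 c₁ σ₀ Φ + bb4 c₂ σ₁ Φ) / 2 + Real.sqrt (Del4 c₁ c₂ σ₀ σ₁ Φ) / 2 := by
    linarith
  have hm1 : 0 < mu1 c₁ c₂ σ₀ σ₁ Φ := Real.sqrt_pos.mpr hrad1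
  have hm2 : 0 < mu2 c₁ c₂ σ₀ σ₁ Φ := Real.sqrt_pos.mpr hrad2
  have hlt : mu2 c₁ c₂ σ₀ σ₁ Φ < mu1 c₁ c₂ σ₀ σ₁ Φ :=
    Real.sqrt_lt_sqrt hrad2.le (by linarith)
  have hS2 := sq_sqrt_Del4 c₁ c₂ σ₀ σ₁ Φ
  have hroot1 : (mu1 c₁ c₂ σ₀ σ₁ Φ ^ 2 - aa4 c₁ σ₀ Φ) * (mu1 c₁ c₂ σ₀ σ₁ Φ ^ 2 - bb4 c₂ σ₁ Φ)
      = (cc4 σ₁ Φ) ^ 2 := by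
    rw [mu1_sq hrad1.le]; linear_combination hS2 / 4
  have hroot2 : (mu2 c₁ c₂ σ₀ σ₁ Φ ^ 2 - aa4 c₁ σ₀ Φ) * (mu2 c₁ c₂ σ₀ σ₁ Φ ^ 2 - bb4 c₂ σ₁ Φ)
      = (cc4 σ₁ Φ) ^ 2 := by
    rw [mu2_sq hrad2.le]; linear_combination hS2 / 4
  refine ⟨⟨hΔ, hrad2, hrad1⟩, ⟨neg_lt_neg hlt, (neg_lt_zero.mpr hm2).trans hm2, hlt⟩,
    ⟨Amat4_mulVec_eq_smul hσ1 hroot1, Amat4_mulVec_eq_smul hσ1 hroot2, ?_, ?_⟩,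
    ?_, fderiv_mu1_s1 hσ1 hΔ hrad1, ?_⟩
  · simpa [s3, mu3] using Amat4_mulVec_eq_smul hσ1 (m := -mu2 c₁ c₂ σ₀ σ₁ Φ)
      (by rwa [neg_sq])
  · simpa [s4, mu4] using Amat4_mulVec_eq_smul hσ1 (m := -mu1 c₁ c₂ σ₀ σ₁ Φ)
      (by rwa [neg_sq])
  · rw [fderiv_mu4, _root_.neg_apply, neg_neg, fderiv_mu1_apply hΔ hrad1,
      fderiv_mu1_apply hΔ hrad1]
    rfl
  · rw [fderiv_mu1_s1 hσ1 hΔ hrad1, mu1_sq hrad1.le]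
    exact div_ne_zero hnum (by positivity)
end
end
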